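/- arXiv:2007.02665 — 4 statements merged into one kernel-verified Lean document; each statement's English description precedes it below -/
import Mathlib

section
/- Suppose the C² cost function c satisfies conditions A1, A2, Ω and Ω* are c-convex with respect to each other, and c satisfies condition A3v. Then for all y₀, y₁ ∈ Ω* and every σ ∈ ℝ, the sub-level set U = {x ∈ Ω : c(x,y₀) − c(x,y₁) ≤ σ} is c-convex with respect to y₀, i.e. the image {−D_y c(x,y₀) : x ∈ U} is a convex subset of ℝⁿ. -/
open Set Filter Topology MeasureTheory RealInnerProductSpace

noncomputable section

/-- Euclidean space ℝⁿ. -/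
abbrev E (n : ℕ) := EuclideanSpace ℝ (Fin n)

/-- Partial gradient of the cost in the `x` variable. -/
noncomputable def Dx {n : ℕ} (c : E n → E n → ℝ) (x y : E n) : E n :=
  gradient (fun x' => c x' y) x

/-- Partial gradient of the cost in the `y` variable. -/
noncomputable def Dy {n : ℕ} (c : E n → E n → ℝ) (x y : E n) : E n :=
  gradient (fun y' => c x y') y

/-- Mixed second derivative `D²_{xy} c (x,y)`, as the derivative in `y` of `x ↦ D_x c(x,y)`,
a continuous linear map acting on vectors of ℝⁿ. -/
noncomputable def Dxy {n : ℕ} (c : E n → E n → ℝ) (x y : E n) : E n →L[ℝ] E n :=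
  fderiv ℝ (fun y' => Dx c x y') y

/-- Quadratic form of the Hessian `D²_{xx} c(x,y)` evaluated at `ξ`. -/
noncomputable def DxxQ {n : ℕ} (c : E n → E n → ℝ) (x y ξ : E n) : ℝ :=
  ⟪(fderiv ℝ (fun x' => Dx c x' y) x) ξ, ξ⟫

/-- `Ω` is a bounded open connected domain. -/
def NiceDomain {n : ℕ} (Ω : Set (E n)) : Prop :=
  Bornology.IsBounded Ω ∧ IsOpen Ω ∧ IsConnected Ω

/-- The cost function is C² on an open neighbourhood of `Ω × Ω*`. -/
def CostC2 {n : ℕ} (Ω Ωs : Set (E n)) (c : E n → E n → ℝ) : Prop :=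
  ∃ U : Set (E n × E n), IsOpen U ∧ Ω ×ˢ Ωs ⊆ U ∧ ContDiffOn ℝ 2 (fun p => c p.1 p.2) U

/-- Condition A1: injectivity of `y ↦ -D_x c(x,y)` on `Ω*` and of `x ↦ -D_y c(x,y)` on `Ω`. -/
def CondA1 {n : ℕ} (Ω Ωs : Set (E n)) (c : E n → E n → ℝ) : Prop :=
  (∀ x ∈ Ω, Set.InjOn (fun y => -Dx c x y) Ωs) ∧
  (∀ y ∈ Ωs, Set.InjOn (fun x => -Dy c x y) Ω)

/-- Condition A2: invertibility of the mixed second derivative `D²_{xy} c`. -/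
def CondA2 {n : ℕ} (Ω Ωs : Set (E n)) (c : E n → E n → ℝ) : Prop :=
  ∀ x ∈ Ω, ∀ y ∈ Ωs, Function.Bijective (Dxy c x y)

/-- `Ω` and `Ω*` are c-convex with respect to each other. -/
def MutuallyCConvex {n : ℕ} (Ω Ωs : Set (E n)) (c : E n → E n → ℝ) : Prop :=
  (∀ x ∈ Ω, Convex ℝ ((fun y => -Dx c x y) '' Ωs)) ∧
  (∀ y ∈ Ωs, Convex ℝ ((fun x => -Dy c x y) '' Ω))

/-- Condition A3v: for every point `y_θ` of the c-segment from `y₀` to `y₁` with respect to `x₀`,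
`max{c(x₀,y₀) − c(x,y₀), c(x₀,y₁) − c(x,y₁)} ≥ c(x₀,y_θ) − c(x,y_θ) + o(|x−x₀|²)` as `x → x₀`. -/
def CondA3v {n : ℕ} (Ω Ωs : Set (E n)) (c : E n → E n → ℝ) : Prop :=
  ∀ x₀ ∈ Ω, ∀ y₀ ∈ Ωs, ∀ y₁ ∈ Ωs, ∀ θ ∈ Ioo (0:ℝ) 1, ∀ yθ ∈ Ωs,
    -Dx c x₀ yθ = (1 - θ) • (-Dx c x₀ y₀) + θ • (-Dx c x₀ y₁) →
    ∃ η : ℝ → ℝ, Tendsto η (𝓝[>] (0:ℝ)) (𝓝 0) ∧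
      ∀ x ∈ Ω, max (c x₀ y₀ - c x y₀) (c x₀ y₁ - c x y₁) ≥
        c x₀ yθ - c x yθ - η ‖x - x₀‖ * ‖x - x₀‖ ^ 2

/-- `φ` is (globally) c-convex on `Ω`: it admits a global c-support at every point. -/
def CConvex {n : ℕ} (Ω Ωs : Set (E n)) (c : E n → E n → ℝ) (φ : E n → ℝ) : Prop :=
  ∀ x₀ ∈ Ω, ∃ y₀ ∈ Ωs, ∃ l : ℝ, (∀ x ∈ Ω, φ x ≥ -l - c x y₀) ∧ φ x₀ = -l - c x₀ y₀

/-- The c-transform `φ^c(y) = sup_{x ∈ Ω} (−φ(x) − c(x,y))`. -/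
noncomputable def CTransform {n : ℕ} (Ω : Set (E n)) (c : E n → E n → ℝ) (φ : E n → ℝ)
    (y : E n) : ℝ :=
  sSup ((fun x => -φ x - c x y) '' Ω)



theorem aux_subgrad {F : Type*} [NormedAddCommGroup F] [NormedSpace ℝ F] [FiniteDimensional ℝ F]
    (S : Set F) (hS : IsOpen S) (f : F → ℝ) (hf : ConvexOn ℝ S f) (x : F) (hx : x ∈ S) :
    ∃ l : F →L[ℝ] ℝ, ∀ y ∈ S, f x + l (y - x) ≤ f y := by
  have hcont : ContinuousOn f S := hf.continuousOn hS
  have hopen : IsOpen {p : F × ℝ | p.1 ∈ S ∧ f p.1 < p.2} := by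
    have h1 : ContinuousOn (fun p : F × ℝ => p.2 - f p.1) (S ×ˢ univ) :=
      continuousOn_snd.sub (hcont.comp continuousOn_fst (fun p hp => hp.1))
    have h2 := h1.isOpen_inter_preimage (hS.prod isOpen_univ) (isOpen_Ioi (a := (0:ℝ)))
    convert h2 using 1
    ext p
    simp
  obtain ⟨L, hL⟩ := geometric_hahn_banach_point_open (x := (x, f x)) hf.convex_strict_epigraph hopen
    (by simp)
  have hlin : ∀ y r, L (y, r) = L (y, 0) + r * L (0, 1) := by
    intro y r
    have : ((y, r) : F × ℝ) = (y, 0) + r • ((0, 1) : F × ℝ) := by simp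
    rw [this, map_add, map_smul, smul_eq_mul]
  have hpos : 0 < L (0, 1) := by
    have := hL (x, f x + 1) ⟨hx, by simp⟩
    rw [hlin x (f x), hlin x (f x + 1)] at this
    linarith
  refine ⟨-(L (0,1))⁻¹ • L.comp (.inl ℝ F ℝ), fun y hy => ?_⟩
  have key : L (x, f x) ≤ L (y, f y) := by
    refine le_of_forall_pos_le_add fun ε hε => ?_
    have := hL (y, f y + ε / L (0,1)) ⟨hy, by simp; positivity⟩
    rw [hlin y (f y + _)] at this
    rw [hlin y (f y)]
    have e : (f y + ε / L (0,1)) * L (0,1) = f y * L (0,1) + ε := by field_simp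
    linarith
  rw [hlin x, hlin y] at key
  have e2 : L (y - x, 0) = L (y, 0) - L (x, 0) := by
    rw [← map_sub]; simp
  simp only [smul_apply, ContinuousLinearMap.comp_apply, ContinuousLinearMap.inl_apply, smul_eq_mul, e2]
  have : (L (0,1))⁻¹ * (L (y,0) - L (x,0)) ≥ (L (0,1))⁻¹ * ((f x - f y) * L (0,1)) := by
    gcongr; linarith
  have e3 : (L (0,1))⁻¹ * ((f x - f y) * L (0,1)) = f x - f y := by field_simp
  linarith

structure PData {V : Type*} [NormedAddCommGroup V] [InnerProductSpace ℝ V]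
    (Ω Ωs : Set V) (P : V → V → V) (Px Py : V → V → V →L[ℝ] V) : Prop where
  oΩ : IsOpen Ω
  oΩs : IsOpen Ωs
  dP : ∀ x ∈ Ω, ∀ y ∈ Ωs,
    HasFDerivAt (fun p : V × V => P p.1 p.2) ((Px x y).coprod (Py x y)) (x, y)
  cPx : ContinuousOn (fun p : V × V => Px p.1 p.2) (Ω ×ˢ Ωs)
  cPy : ContinuousOn (fun p : V × V => Py p.1 p.2) (Ω ×ˢ Ωs)
  bij : ∀ x ∈ Ω, ∀ y ∈ Ωs, Function.Bijective (Py x y)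
  inj : ∀ x ∈ Ω, Set.InjOn (P x) Ωs
  cvx : ∀ x ∈ Ω, Convex ℝ (P x '' Ωs)
  a3 : ∀ x ∈ Ω, ∀ y₀ ∈ Ωs, ∀ y₁ ∈ Ωs, ∀ yθ ∈ Ωs, ∀ θ ∈ Ioo (0:ℝ) 1,
    P x yθ = (1 - θ) • P x y₀ + θ • P x y₁ → ∀ ξ : V, ⟪P x y₁ - P x y₀, ξ⟫ = 0 →
    ⟪Px x yθ ξ, ξ⟫ ≤ (1 - θ) * ⟪Px x y₀ ξ, ξ⟫ + θ * ⟪Px x y₁ ξ, ξ⟫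

namespace PData
variable {V : Type*} [NormedAddCommGroup V] [InnerProductSpace ℝ V] [FiniteDimensional ℝ V]
    {Ω Ωs : Set V} {P : V → V → V} {Px Py : V → V → V →L[ℝ] V}

theorem strict (D : PData Ω Ωs P Px Py) {x y : V} (hx : x ∈ Ω) (hy : y ∈ Ωs) :
    HasStrictFDerivAt (fun p : V × V => P p.1 p.2) ((Px x y).coprod (Py x y)) (x, y) := by
  have hU : Ω ×ˢ Ωs ∈ 𝓝 (x, y) := (D.oΩ.prod D.oΩs).mem_nhds ⟨hx, hy⟩
  refine hasStrictFDerivAt_of_hasFDerivAt_of_continuousAt (x := (x, y))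
    (f' := fun p : V × V => (Px p.1 p.2).coprod (Py p.1 p.2)) ?_ ?_
  · filter_upwards [hU] with p hp using D.dP p.1 hp.1 p.2 hp.2
  · have h1 := D.cPx.continuousAt hU
    have h2 := D.cPy.continuousAt hU
    have : (fun p : V × V => (Px p.1 p.2).coprod (Py p.1 p.2)) =
      fun p : V × V => (Px p.1 p.2).comp (.fst ℝ V V) + (Py p.1 p.2).comp (.snd ℝ V V) := by
      ext p q <;> simp
    rw [this]
    exact (h1.clm_comp continuousAt_const).add (h2.clm_comp continuousAt_const)

theorem cP (D : PData Ω Ωs P Px Py) : ContinuousOn (fun p : V × V => P p.1 p.2) (Ω ×ˢ Ωs) :=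
  fun p hp => (D.dP p.1 hp.1 p.2 hp.2).continuousAt.continuousWithinAt

theorem local_surj (D : PData Ω Ωs P Px Py) {x₀ y₀ : V} (hx : x₀ ∈ Ω) (hy : y₀ ∈ Ωs) :
    ∃ r > 0, ∃ ρ > 0, ∃ K : ℝ, 0 ≤ K ∧ Metric.ball x₀ r ⊆ Ω ∧ ∀ x ∈ Metric.ball x₀ r,
      ∀ p ∈ Metric.ball (P x y₀) ρ, ∃ y ∈ Ωs, P x y = p ∧ ‖Px x y‖ ≤ K := by
  have hU : Ω ×ˢ Ωs ∈ 𝓝 (x₀, y₀) := (D.oΩ.prod D.oΩs).mem_nhds ⟨hx, hy⟩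
  set K := ‖Px x₀ y₀‖ + 1 with hK
  have hN : {p : V × V | p ∈ Ω ×ˢ Ωs ∧ ‖Px p.1 p.2‖ < K} ∈ 𝓝 (x₀, y₀) := by
    have h1 := (D.cPx.continuousAt hU).norm
    filter_upwards [hU, h1.eventually (gt_mem_nhds (show ‖Px x₀ y₀‖ < K by simp [hK]))] with p h1 h2
    exact ⟨h1, h2⟩
  have hst : HasStrictFDerivAt (fun p : V × V => (p.1, P p.1 p.2))
      ((ContinuousLinearMap.fst ℝ V V).prod ((Px x₀ y₀).coprod (Py x₀ y₀))) (x₀, y₀) :=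
    hasStrictFDerivAt_fst.prodMk (D.strict hx hy)
  have hsurj : ((ContinuousLinearMap.fst ℝ V V).prod ((Px x₀ y₀).coprod (Py x₀ y₀))).range = ⊤ := by
    rw [LinearMap.range_eq_top]
    rintro ⟨a, b⟩
    obtain ⟨c, hc⟩ := (D.bij x₀ hx y₀ hy).2 (b - Px x₀ y₀ a)
    exact ⟨(a, c), by simp [hc]⟩
  have hmap := hst.map_nhds_eq_of_surj hsurj
  have him : (fun p : V × V => (p.1, P p.1 p.2)) ''
      {p : V × V | p ∈ Ω ×ˢ Ωs ∧ ‖Px p.1 p.2‖ < K} ∈ 𝓝 (x₀, P x₀ y₀) := by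
    have := Filter.image_mem_map (m := (fun p : V × V => (p.1, P p.1 p.2))) hN
    rwa [hmap] at this
  obtain ⟨ρ, hρ, hball⟩ := Metric.mem_nhds_iff.1 him
  have hc : ContinuousAt (fun x => P x y₀) x₀ :=
    (D.dP x₀ hx y₀ hy).continuousAt.comp (f := fun x => (x, y₀)) (by fun_prop)
  obtain ⟨r1, hr1, hr1'⟩ := Metric.continuousAt_iff.1 hc (ρ/2) (by positivity)
  obtain ⟨r2, hr2, hr2'⟩ := Metric.isOpen_iff.1 D.oΩ x₀ hx
  refine ⟨min (min r1 r2) ρ, by positivity, ρ/2, by positivity, K, by positivity, ?_, ?_⟩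
  · exact (Metric.ball_subset_ball (by simp)).trans hr2'
  · intro x hxb p hp
    have hx1 : dist x x₀ < r1 := lt_of_lt_of_le hxb (by simp)
    have hx3 : dist x x₀ < ρ := lt_of_lt_of_le hxb (by simp)
    have : (x, p) ∈ Metric.ball (x₀, P x₀ y₀) ρ := by
      rw [Metric.mem_ball, Prod.dist_eq, max_lt_iff]
      refine ⟨hx3, ?_⟩
      have := dist_triangle p (P x y₀) (P x₀ y₀)
      have h4 := hr1' hx1
      have h5 : dist p (P x y₀) < ρ/2 := hp
      simp only at *
      linarith
    obtain ⟨q, ⟨hq1, hq2⟩, hq3⟩ := hball this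
    simp only [Prod.mk.injEq] at hq3
    obtain ⟨h3, h4⟩ := hq3
    subst h3
    exact ⟨q.2, hq1.2, h4, hq2.le⟩

theorem subgrad (D : PData Ω Ωs P Px Py) {x₀ y₀ : V} (hx : x₀ ∈ Ω) (hy : y₀ ∈ Ωs) (R : ℝ) :
    ∃ r > 0, ∃ S : ℝ, 0 ≤ S ∧ Metric.ball x₀ r ⊆ Ω ∧ ∀ x ∈ Metric.ball x₀ r, ∀ ξ : V, ‖ξ‖ ≤ R →
      ∃ s : V, ‖s‖ ≤ S ∧ ∀ y ∈ Ωs, ⟪P x y - P x y₀, ξ⟫ = 0 →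
        ⟪s, P x y - P x y₀⟫ ≤ ⟪Px x y ξ, ξ⟫ - ⟪Px x y₀ ξ, ξ⟫ := by
  obtain ⟨r, hr, ρ, hρ, K, hK, hsub, hloc⟩ := D.local_surj hx hy
  refine ⟨r, hr, (2 * K * R^2) * 2 / ρ, by positivity, hsub, fun x hxb ξ hξ => ?_⟩
  have hxΩ := hsub hxb
  have hR : 0 ≤ R := (norm_nonneg _).trans hξ
  set p₀ := P x y₀ with hp₀
  -- image is open
  have hop : IsOpen (P x '' Ωs) := by
    rw [isOpen_iff_mem_nhds]
    rintro _ ⟨y, hy', rfl⟩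
    obtain ⟨r', hr', ρ', hρ', K', -, -, hloc'⟩ := D.local_surj hxΩ hy'
    refine Filter.mem_of_superset (Metric.ball_mem_nhds _ hρ') fun p hp => ?_
    obtain ⟨z, hz, hz', -⟩ := hloc' x (Metric.mem_ball_self hr') p hp
    exact ⟨z, hz, hz'⟩
  set W : Submodule ℝ V := (ℝ ∙ ξ)ᗮ with hW
  have hWmem : ∀ v : V, v ∈ W ↔ ⟪v, ξ⟫ = 0 := fun v => by
    rw [hW, Submodule.mem_orthogonal_singleton_iff_inner_left]
  set T : Set W := {η : W | p₀ + (η : V) ∈ P x '' Ωs} with hT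
  have hTo : IsOpen T := hop.preimage (f := fun η : W => p₀ + (η : V)) (by fun_prop)
  have h0T : (0 : W) ∈ T := by simp only [hT, mem_ofPred_eq]; exact ⟨y₀, hy, by simp [hp₀]⟩
  have hch : ∀ η ∈ T, ∃ y ∈ Ωs, P x y = p₀ + (η : V) := fun η hη => hη
  choose! Y hY1 hY2 using hch
  let f : W → ℝ := fun η => ⟪Px x (Y η) ξ, ξ⟫
  have hf : ConvexOn ℝ T f := by
    have hTc : Convex ℝ T := by
      intro a ha b hb s t hs ht hst
      have := D.cvx x hxΩ ha hb hs ht hst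
      simp only [hT, mem_ofPred_eq]
      convert this using 1
      have : p₀ = s • p₀ + t • p₀ := by rw [← add_smul, hst, one_smul]
      push_cast
      nth_rewrite 1 [this]
      module
    refine convexOn_iff_forall_pos.2 ⟨hTc, fun a ha b hb s t hs ht hst => ?_⟩
    have hm : s • a + t • b ∈ T := hTc ha hb hs.le ht.le hst
    have hs' : s = 1 - t := by linarith
    have := D.a3 x hxΩ (Y a) (hY1 a ha) (Y b) (hY1 b hb) (Y (s • a + t • b)) (hY1 _ hm) t
      ⟨ht, by linarith⟩ (by
        rw [hY2 _ ha, hY2 _ hb, hY2 _ hm, hs']; push_cast; module) ξ (by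
        rw [hY2 _ ha, hY2 _ hb]
        have h1 := (hWmem _).1 a.2
        have h2 := (hWmem _).1 b.2
        simp only [add_sub_add_left_eq_sub, inner_sub_left, h1, h2, sub_zero])
    simp only [f, smul_eq_mul]
    rw [hs'] at this ⊢
    exact this
  obtain ⟨l, hl⟩ := aux_subgrad T hTo f hf 0 h0T
  have hY0 : Y 0 = y₀ := D.inj x hxΩ (hY1 0 h0T) hy (by rw [hY2 0 h0T]; simp [hp₀])
  have hf0 : f 0 = ⟪Px x y₀ ξ, ξ⟫ := by simp [f, hY0]
  have hbnd : ∀ y, ‖Px x y‖ ≤ K → |⟪Px x y ξ, ξ⟫| ≤ K * R^2 := fun y hyK => by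
    calc |⟪Px x y ξ, ξ⟫| ≤ ‖Px x y ξ‖ * ‖ξ‖ := abs_real_inner_le_norm _ _
      _ ≤ (‖Px x y‖ * ‖ξ‖) * ‖ξ‖ := by gcongr; exact (Px x y).le_opNorm ξ
      _ ≤ (K * R) * R := by gcongr
      _ = _ := by ring
  let s : W := (InnerProductSpace.toDual ℝ W).symm l
  have hs : ∀ η : W, ⟪s, η⟫ = l η := fun η => by simp [s, InnerProductSpace.toDual_symm_apply]
  refine ⟨(s : V), ?_, ?_⟩
  · -- bound
    by_cases hs0 : s = 0
    · simp only [hs0]; simp; positivity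
    have hsn : 0 < ‖s‖ := norm_pos_iff.2 hs0
    let η : W := (ρ / 2 / ‖s‖) • s
    have hηn : ‖(η : V)‖ = ρ/2 := by
      rw [← Submodule.coe_norm]; simp only [η, norm_smul, Real.norm_eq_abs]
      rw [abs_of_pos (by positivity)]; field_simp
    obtain ⟨y, hyΩ, hyP, hyK⟩ := hloc x hxb (p₀ + (η : V)) (by
      rw [Metric.mem_ball, dist_eq_norm]; rw [← hp₀, add_sub_cancel_left, hηn]; linarith)
    have hηT : η ∈ T := ⟨y, hyΩ, hyP⟩
    have hYη : Y η = y := D.inj x hxΩ (hY1 η hηT) hyΩ (by rw [hY2 η hηT, hyP])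
    obtain ⟨y', hy'Ω, hy'P, hy'K⟩ := hloc x hxb p₀ (Metric.mem_ball_self hρ)
    have hyy : y' = y₀ := D.inj x hxΩ hy'Ω hy hy'P
    rw [hyy] at hy'K
    have h1 := hl η hηT
    rw [sub_zero, ← hs, hf0] at h1
    have h2 : ⟪s, η⟫ = ρ / 2 * ‖s‖ := by
      simp only [η, inner_smul_right, real_inner_self_eq_norm_sq]; field_simp
    have h3 : f η = ⟪Px x y ξ, ξ⟫ := by simp [f, hYη]
    have h4 := abs_le.1 (hbnd y hyK)
    have h5 := abs_le.1 (hbnd y₀ hy'K)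
    rw [h2, h3] at h1
    rw [← Submodule.coe_norm, le_div_iff₀ hρ]
    nlinarith
  · intro y hyΩ hyξ
    let η : W := ⟨P x y - p₀, (hWmem _).2 hyξ⟩
    have hηT : η ∈ T := ⟨y, hyΩ, by simp [η]⟩
    have hYη : Y η = y := D.inj x hxΩ (hY1 η hηT) hyΩ (by rw [hY2 η hηT]; simp [η])
    have h1 := hl η hηT
    rw [sub_zero, ← hs, hf0] at h1
    have h3 : f η = ⟪Px x y ξ, ξ⟫ := by simp [f, hYη]
    have h4 : ⟪s, η⟫ = ⟪(s : V), P x y - p₀⟫ := by rw [Submodule.coe_inner]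
    rw [← h4]; linarith
end PData



theorem aux_discrete (W : ℕ → ℝ → ℝ) (N : ℕ) (κ L h ε δ B : ℝ) (hκ : 0 < κ) (hh : 0 < h)
    (hε : 0 ≤ ε) (hδ0 : 0 ≤ δ)
    (hc : ∀ k ≤ N, ContinuousOn (W k) (Icc (-δ) B))
    (mono : ∀ k ≤ N, ∀ b ∈ Icc (-δ) B, ∀ b' ∈ Icc (-δ) B, b ≤ b' → W k b + κ * (b' - b) ≤ W k b')
    (lip : ∀ k < N, ∀ b ∈ Icc (-δ) B, W k b - L * h ≤ W (k+1) b)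
    (zero : ∀ k < N, ∀ b ∈ Icc (-δ) B, W k b = 0 → -(ε * h) ≤ W (k+1) b)
    (hδ : L * h ≤ κ * δ) (hB : N * (ε * h) / κ ≤ B) (h0 : 0 ≤ W 0 0) :
    ∀ k ≤ N, 0 ≤ W k (k * (ε * h) / κ) := by
  intro k
  induction k with
  | zero => intro _; simpa using h0
  | succ k ih =>
    intro hk
    have ih := ih (by omega)
    set b : ℝ := k * (ε * h) / κ with hb
    have hb' : ((k + 1 : ℕ) : ℝ) * (ε * h) / κ = b + ε * h / κ := by
      rw [hb]; push_cast; ring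
    rw [hb']
    have hb0 : 0 ≤ b := by positivity
    have hβ : 0 ≤ ε * h / κ := by positivity
    have hbB : b + ε * h / κ ≤ B := by
      rw [← hb']; refine le_trans ?_ hB; gcongr
    have hmb : b ∈ Icc (-δ) B := ⟨by linarith, by linarith⟩
    have hmb' : b + ε * h / κ ∈ Icc (-δ) B := ⟨by linarith, by linarith⟩
    have hmd : b - δ ∈ Icc (-δ) B := ⟨by linarith, by linarith⟩
    have hkN : k < N := by omega
    by_cases hcase : 0 ≤ W k (b - δ)
    · have h1 := mono k hkN.le _ hmd _ hmb (by linarith)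
      have h2 := lip k hkN b hmb
      have h3 := mono (k+1) hk _ hmb _ hmb' (by linarith)
      have h4 : 0 ≤ κ * (b + ε * h / κ - b) := by apply mul_nonneg hκ.le; linarith
      have h5 : κ * (b - (b - δ)) = κ * δ := by ring
      linarith
    · push Not at hcase
      obtain ⟨b', hb'm, hb'0⟩ := intermediate_value_Icc (show b - δ ≤ b by linarith)
        ((hc k hkN.le).mono (Icc_subset_Icc hmd.1 hmb.2)) ⟨hcase.le, ih⟩
      have hm' : b' ∈ Icc (-δ) B := ⟨by linarith [hb'm.1], by linarith [hb'm.2]⟩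
      have h1 := zero k hkN b' hm' hb'0
      have h2 := mono (k+1) hk _ hm' _ hmb' (by linarith [hb'm.2])
      have h3 : κ * (b + ε * h / κ - b') ≥ ε * h := by
        have : κ * (b + ε * h / κ - b') = κ * (b - b') + ε * h := by field_simp; ring
        have h6 : 0 ≤ κ * (b - b') := mul_nonneg hκ.le (by linarith [hb'm.2])
        linarith
      linarith

section lim
variable {V : Type*} [NormedAddCommGroup V] [InnerProductSpace ℝ V] [FiniteDimensional ℝ V]

/-- Euler scheme. -/
def euler (σ : V × V → V) (h : ℝ) (z : V × V) : ℕ → V × V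
  | 0 => z
  | k + 1 => ((euler σ h z k).1 + h • (euler σ h z k).2,
      (euler σ h z k).2 - h • σ (euler σ h z k))

theorem euler_xi (σ : V × V → V) (S h : ℝ) (hh : 0 ≤ h) (hσ : ∀ z, ‖σ z‖ ≤ S) (z : V × V)
    (k j : ℕ) : ‖(euler σ h z (k + j)).2 - (euler σ h z k).2‖ ≤ S * (j * h) := by
  induction j with
  | zero => simp
  | succ j ih =>
    have : (euler σ h z (k + (j + 1))).2 - (euler σ h z k).2 =
      ((euler σ h z (k + j)).2 - (euler σ h z k).2) - h • σ (euler σ h z (k+j)) := by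
      rw [← add_assoc]; simp only [euler]; abel
    rw [this]
    calc _ ≤ S * (j * h) + h * S := by
          refine (norm_sub_le _ _).trans (add_le_add ih ?_)
          rw [norm_smul, Real.norm_of_nonneg hh]; gcongr; exact hσ _
      _ = _ := by push_cast; ring

theorem euler_x (σ : V × V → V) (S h : ℝ) (hh : 0 ≤ h) (hσ : ∀ z, ‖σ z‖ ≤ S) (z : V × V)
    (k j : ℕ) : ‖(euler σ h z (k + j)).1 - (euler σ h z k).1 - (j * h) • (euler σ h z k).2‖
      ≤ S * (j * h)^2 := by
  have hS : 0 ≤ S := (norm_nonneg _).trans (hσ z)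
  induction j with
  | zero => simp
  | succ j ih =>
    have : (euler σ h z (k + (j + 1))).1 - (euler σ h z k).1 - ((j+1 : ℕ) * h) • (euler σ h z k).2 =
      ((euler σ h z (k + j)).1 - (euler σ h z k).1 - (j * h) • (euler σ h z k).2)
       + h • ((euler σ h z (k+j)).2 - (euler σ h z k).2) := by
      rw [← add_assoc]; simp only [euler]; push_cast; module
    rw [this]
    calc _ ≤ S * (j * h)^2 + h * (S * (j * h)) := by
          refine (norm_add_le _ _).trans (add_le_add ih ?_)
          rw [norm_smul, Real.norm_of_nonneg hh]; gcongr; exact euler_xi σ S h hh hσ z k j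
      _ ≤ S * ((j+1:ℕ) * h)^2 := by
        push_cast
        have : 0 ≤ S * h^2 * (j + 1) := by positivity
        nlinarith

/-- step index -/
def kk (m : ℕ) (t : ℝ) : ℕ := ⌊t * (m + 1)⌋₊
def hh (m : ℕ) : ℝ := 1 / ((m : ℝ) + 1)

theorem hh_pos (m : ℕ) : 0 < hh m := by unfold hh; positivity
theorem hh_tendsto : Tendsto hh atTop (𝓝 0) := tendsto_one_div_add_atTop_nhds_zero_nat

theorem kk_le (m : ℕ) {t : ℝ} (ht : 0 ≤ t) : kk m t * hh m ≤ t := by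
  have := Nat.floor_le (show 0 ≤ t * (m + 1) by positivity)
  unfold kk hh
  rw [mul_one_div, div_le_iff₀ (by positivity)]; exact this

theorem kk_gt (m : ℕ) (t : ℝ) : t - hh m ≤ kk m t * hh m := by
  have hfl := Nat.lt_floor_add_one (t * (m + 1))
  have h2 : t = t * (m+1) * hh m := by unfold hh; field_simp
  have h3 : t * (m+1) * hh m ≤ (kk m t + 1) * hh m := by
    have := hh_pos m
    gcongr
    exact hfl.le
  rw [← h2] at h3
  linarith

theorem kk_tendsto {t : ℝ} (ht : 0 ≤ t) : Tendsto (fun m => kk m t * hh m) atTop (𝓝 t) := by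
  refine tendsto_of_tendsto_of_tendsto_of_le_of_le (g := fun m => t - hh m) (h := fun _ => t) ?_
    tendsto_const_nhds (fun m => kk_gt m t) (fun m => kk_le m ht)
  simpa using tendsto_const_nhds.sub hh_tendsto

theorem kk_mono (m : ℕ) {t t' : ℝ} (h : t ≤ t') : kk m t ≤ kk m t' := by
  unfold kk; gcongr

theorem euler_limit (σ : V × V → V) (S : ℝ) (hσ : ∀ z, ‖σ z‖ ≤ S) (z : V × V) :
    ∃ Z : ℝ → V × V, (Z 0 = z) ∧
      (∀ t ≥ 0, Tendsto (fun m => euler σ (hh m) z (kk m t)) (hyperfilter ℕ) (𝓝 (Z t))) ∧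
      (∀ t t', 0 ≤ t → t ≤ t' → ‖(Z t').2 - (Z t).2‖ ≤ S * (t' - t)) ∧
      (∀ t t', 0 ≤ t → t ≤ t' → ‖(Z t').1 - (Z t).1 - (t' - t) • (Z t).2‖ ≤ S * (t' - t)^2) := by
  have hS : 0 ≤ S := (norm_nonneg _).trans (hσ z)
  have hex : ∀ t : ℝ, 0 ≤ t → ∃ w : V × V,
      Tendsto (fun m => euler σ (hh m) z (kk m t)) (hyperfilter ℕ) (𝓝 w) := by
    intro t ht
    have hb : ∀ m, euler σ (hh m) z (kk m t) ∈
        Metric.closedBall z.1 (t * ‖z.2‖ + S * t^2) ×ˢ Metric.closedBall z.2 (S * t) := by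
      intro m
      have h1 := euler_xi σ S (hh m) (hh_pos m).le hσ z 0 (kk m t)
      have h2 := euler_x σ S (hh m) (hh_pos m).le hσ z 0 (kk m t)
      have h3 := kk_le m ht
      have h4 : 0 ≤ kk m t * hh m := by have := hh_pos m; positivity
      rw [zero_add] at h1 h2
      simp only [euler] at h1 h2
      constructor
      · rw [mem_closedBall_iff_norm]
        calc _ = ‖((euler σ (hh m) z (kk m t)).1 - z.1 - (kk m t * hh m) • z.2) + (kk m t * hh m) • z.2‖ := by
              congr 1; abel
          _ ≤ S * (kk m t * hh m)^2 + (kk m t * hh m) * ‖z.2‖ := by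
              refine (norm_add_le _ _).trans (add_le_add h2 ?_)
              rw [norm_smul, Real.norm_of_nonneg h4]
          _ ≤ S * t^2 + t * ‖z.2‖ := by gcongr
          _ = _ := by ring
      · rw [mem_closedBall_iff_norm]
        exact h1.trans (by gcongr)
    have hcomp := (isCompact_closedBall z.1 (t * ‖z.2‖ + S * t^2)).prod
      (isCompact_closedBall z.2 (S * t))
    obtain ⟨w, -, hw⟩ := hcomp.ultrafilter_le_nhds
      ((hyperfilter ℕ).map (fun m => euler σ (hh m) z (kk m t)))
      (by rw [le_principal_iff]; exact Filter.mem_map.2 (Filter.univ_mem' hb))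
    exact ⟨w, hw⟩
  choose! Z hZ using hex
  refine ⟨Z, ?_, hZ, ?_, ?_⟩
  · have h1 := hZ 0 le_rfl
    have : (fun m => euler σ (hh m) z (kk m 0)) = fun _ => z := by
      funext m; simp [kk, euler]
    rw [this] at h1
    exact tendsto_nhds_unique h1 tendsto_const_nhds
  · intro t t' ht htt
    have h1 := hZ t ht
    have h2 := hZ t' (ht.trans htt)
    have h3 : Tendsto (fun m => ‖(euler σ (hh m) z (kk m t')).2 - (euler σ (hh m) z (kk m t)).2‖)
      (hyperfilter ℕ) (𝓝 ‖(Z t').2 - (Z t).2‖) :=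
      (((continuous_snd.tendsto _).comp h2).sub ((continuous_snd.tendsto _).comp h1)).norm
    have h4 : Tendsto (fun m => S * (kk m t' * hh m - kk m t * hh m)) (hyperfilter ℕ)
        (𝓝 (S * (t' - t))) :=
      (((kk_tendsto (ht.trans htt)).sub (kk_tendsto ht)).const_mul S).mono_left
        Nat.hyperfilter_le_atTop
    refine le_of_tendsto_of_tendsto h3 h4 (Eventually.of_forall fun m => ?_)
    obtain ⟨j, hj⟩ := Nat.exists_eq_add_of_le (kk_mono m htt)
    have := euler_xi σ S (hh m) (hh_pos m).le hσ z (kk m t) j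
    simp only [hj]
    refine this.trans (le_of_eq ?_)
    push_cast; ring
  · intro t t' ht htt
    have h1 := hZ t ht
    have h2 := hZ t' (ht.trans htt)
    have hk : Tendsto (fun m => (kk m t' * hh m - kk m t * hh m)) (hyperfilter ℕ)
        (𝓝 (t' - t)) :=
      ((kk_tendsto (ht.trans htt)).sub (kk_tendsto ht)).mono_left
        Nat.hyperfilter_le_atTop
    have h3 : Tendsto (fun m => ‖(euler σ (hh m) z (kk m t')).1 - (euler σ (hh m) z (kk m t)).1
        - (kk m t' * hh m - kk m t * hh m) • (euler σ (hh m) z (kk m t)).2‖)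
      (hyperfilter ℕ) (𝓝 ‖(Z t').1 - (Z t).1 - (t' - t) • (Z t).2‖) :=
      ((((continuous_fst.tendsto _).comp h2).sub ((continuous_fst.tendsto _).comp h1)).sub
       (hk.smul ((continuous_snd.tendsto _).comp h1))).norm
    have h4 : Tendsto (fun m => S * (kk m t' * hh m - kk m t * hh m)^2) (hyperfilter ℕ)
        (𝓝 (S * (t' - t)^2)) := (hk.pow 2).const_mul S
    refine le_of_tendsto_of_tendsto h3 h4 (Eventually.of_forall fun m => ?_)
    obtain ⟨j, hj⟩ := Nat.exists_eq_add_of_le (kk_mono m htt)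
    have := euler_x σ S (hh m) (hh_pos m).le hσ z (kk m t) j
    have e : ((kk m t' : ℕ) : ℝ) * hh m - kk m t * hh m = j * hh m := by
      rw [hj]; push_cast; ring
    simp only [e]
    rw [hj]
    exact this
end lim

namespace PData
variable {V : Type*} [NormedAddCommGroup V] [InnerProductSpace ℝ V] [FiniteDimensional ℝ V]
    {Ω Ωs : Set V} {P : V → V → V} {Px Py : V → V → V →L[ℝ] V}

theorem dPx (D : PData Ω Ωs P Px Py) {x y : V} (hx : x ∈ Ω) (hy : y ∈ Ωs) :
    HasFDerivAt (fun x => P x y) (Px x y) x := by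
  have h := (D.dP x hx y hy).comp (f := fun x => (x, y)) x
    ((hasFDerivAt_id x).prodMk (hasFDerivAt_const y x))
  refine h.congr_fderiv ?_
  refine ContinuousLinearMap.ext fun v => ?_
  simp

theorem dPy (D : PData Ω Ωs P Px Py) {x y : V} (hx : x ∈ Ω) (hy : y ∈ Ωs) :
    HasFDerivAt (fun y => P x y) (Py x y) y := by
  have h := (D.dP x hx y hy).comp (f := fun y => (x, y)) y
    ((hasFDerivAt_const x y).prodMk (hasFDerivAt_id y))
  refine h.congr_fderiv ?_
  refine ContinuousLinearMap.ext fun v => ?_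
  simp

theorem unif (D : PData Ω Ωs P Px Py) {x₀ y₁ : V} {r : ℝ} (hx : Metric.closedBall x₀ r ⊆ Ω)
    (hy : Metric.closedBall y₁ r ⊆ Ωs) (e : ℝ) (he : 0 < e) :
    ∃ δ > 0, ∀ x ∈ Metric.closedBall x₀ r, ∀ x' ∈ Metric.closedBall x₀ r,
      ∀ y ∈ Metric.closedBall y₁ r, ‖x' - x‖ < δ →
        ‖P x' y - P x y - Px x y (x' - x)‖ ≤ e * ‖x' - x‖ := by
  have hcomp := (isCompact_closedBall x₀ r).prod (isCompact_closedBall y₁ r)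
  have huc := hcomp.uniformContinuousOn_of_continuous (D.cPx.mono (prod_mono hx hy))
  obtain ⟨δ, hδ, h⟩ := Metric.uniformContinuousOn_iff.1 huc e he
  refine ⟨δ, hδ, fun x hxm x' hx' y hym hd => ?_⟩
  refine Convex.norm_image_sub_le_of_norm_hasFDerivWithin_le' (f := fun x => P x y)
    (f' := fun x => Px x y)
    (s := Metric.closedBall x₀ r ∩ Metric.ball x δ) (fun z hz =>
      (D.dPx (hx hz.1) (hy hym)).hasFDerivWithinAt) (fun z hz => ?_)
      ((convex_closedBall _ _).inter (convex_ball _ _)) ⟨hxm, Metric.mem_ball_self hδ⟩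
      ⟨hx', by rwa [mem_ball_iff_norm]⟩
  have := h (z, y) ⟨hz.1, hym⟩ (x, y) ⟨hxm, hym⟩ (by
    rw [Prod.dist_eq, max_lt_iff]; exact ⟨hz.2, by simpa using hδ⟩)
  rw [dist_eq_norm] at this
  exact this.le

theorem step (D : PData Ω Ωs P Px Py) {x₀ y₀ y₁ ξ₀ : V} {r : ℝ} (hr : 0 < r)
    (hx : Metric.closedBall x₀ r ⊆ Ω)
    (hy0 : Metric.closedBall y₀ r ⊆ Ωs) (hy : Metric.closedBall y₁ r ⊆ Ωs) (S : ℝ) (hS : 0 ≤ S) :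
    ∃ L : ℝ, 0 ≤ L ∧ ∀ ε > 0, ∃ h₀ > 0, ∀ h, 0 < h → h < h₀ → ∀ x ξ s y : V,
      x ∈ Metric.closedBall x₀ r → x + h • ξ ∈ Metric.closedBall x₀ r →
      ξ ∈ Metric.closedBall ξ₀ r → ‖s‖ ≤ S → y ∈ Metric.closedBall y₁ r →
      |(⟪Px x y ξ, ξ⟫ - ⟪Px x y₀ ξ, ξ⟫) - ⟪s, P x y - P x y₀⟫| ≤ L ∧
      |⟪P (x + h • ξ) y - P (x + h • ξ) y₀, ξ - h • s⟫ - ⟪P x y - P x y₀, ξ⟫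
        - h * ((⟪Px x y ξ, ξ⟫ - ⟪Px x y₀ ξ, ξ⟫) - ⟪s, P x y - P x y₀⟫)| ≤ ε * h := by
  have hy00 : y₀ ∈ Metric.closedBall y₀ r := Metric.mem_closedBall_self hr.le
  have bd : ∀ z, Metric.closedBall z r ⊆ Ωs → ∃ M : ℝ, 0 ≤ M ∧ ∀ x ∈ Metric.closedBall x₀ r,
      ∀ y ∈ Metric.closedBall z r, ‖P x y‖ ≤ M ∧ ‖Px x y‖ ≤ M := by
    intro z hz
    have hcomp := (isCompact_closedBall x₀ r).prod (isCompact_closedBall z r)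
    obtain ⟨M1, hM1⟩ := hcomp.exists_bound_of_continuousOn (D.cP.mono (prod_mono hx hz))
    obtain ⟨M2, hM2⟩ := hcomp.exists_bound_of_continuousOn (D.cPx.mono (prod_mono hx hz))
    refine ⟨max 0 (max M1 M2), by simp, fun x hx' y hy' => ⟨?_, ?_⟩⟩
    · exact (hM1 (x, y) ⟨hx', hy'⟩).trans (by simp)
    · exact (hM2 (x, y) ⟨hx', hy'⟩).trans (by simp)
  obtain ⟨M0, hM00, hM0⟩ := bd y₀ hy0
  obtain ⟨M1, hM10, hM1⟩ := bd y₁ hy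
  set R := ‖ξ₀‖ + r with hR
  have hR0 : 0 < R := by positivity
  set M := M0 + M1 with hM
  refine ⟨M * R * R + S * M, by positivity, fun ε hε => ?_⟩
  set e := ε / (4 * R * (R + S)) with he
  have he0 : 0 < e := by positivity
  obtain ⟨δ0, hδ0, h0⟩ := D.unif hx hy0 e he0
  obtain ⟨δ1, hδ1, h1⟩ := D.unif hx hy e he0
  refine ⟨min 1 (min (min (δ0 / R) (δ1 / R)) (ε / (2 * (M * R * S + 1)))), by positivity, ?_⟩
  intro h hh hlt x ξ s y hxm hxm' hξ hs hym
  simp only [lt_min_iff] at hlt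
  obtain ⟨hl1, ⟨hl2, hl3⟩, hl4⟩ := hlt
  have hξR : ‖ξ‖ ≤ R := by
    have := norm_le_norm_add_norm_sub' ξ ξ₀
    rw [mem_closedBall_iff_norm] at hξ
    linarith
  set G := P x y - P x y₀ with hG
  set dG := Px x y ξ - Px x y₀ ξ with hdG
  have hGM : ‖G‖ ≤ M := (norm_sub_le _ _).trans (by
    have := (hM0 x hxm y₀ hy00).1; have := (hM1 x hxm y hym).1; linarith)
  have hdGM : ‖dG‖ ≤ M * R := by
    have e1 : dG = (Px x y - Px x y₀) ξ := by simp [hdG]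
    have e2 : ‖Px x y - Px x y₀‖ ≤ M := (norm_sub_le _ _).trans (by
      have := (hM0 x hxm y₀ hy00).2; have := (hM1 x hxm y hym).2; linarith)
    rw [e1]; exact (ContinuousLinearMap.le_opNorm _ _).trans (by gcongr)
  have e0 : ⟪Px x y ξ, ξ⟫ - ⟪Px x y₀ ξ, ξ⟫ = ⟪dG, ξ⟫ := by rw [hdG, inner_sub_left]
  rw [e0]
  constructor
  · calc |⟪dG, ξ⟫ - ⟪s, G⟫| ≤ |⟪dG, ξ⟫| + |⟪s, G⟫| := abs_sub _ _
      _ ≤ ‖dG‖ * ‖ξ‖ + ‖s‖ * ‖G‖ := add_le_add (abs_real_inner_le_norm _ _) (abs_real_inner_le_norm _ _)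
      _ ≤ (M * R) * R + S * M := by gcongr
  · have hnh : ‖x + h • ξ - x‖ ≤ h * R := by
      rw [add_sub_cancel_left, norm_smul, Real.norm_of_nonneg hh.le]; gcongr
    have a0 := h0 x hxm _ hxm' y₀ hy00 (hnh.trans_lt (by rwa [lt_div_iff₀ hR0] at hl2))
    have a1 := h1 x hxm _ hxm' y hym (hnh.trans_lt (by rwa [lt_div_iff₀ hR0] at hl3))
    set E0 := P (x + h • ξ) y₀ - P x y₀ - Px x y₀ (x + h • ξ - x) with hE0
    set E1 := P (x + h • ξ) y - P x y - Px x y (x + h • ξ - x) with hE1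
    have b0 : ‖E0‖ ≤ e * (h * R) := a0.trans (by gcongr)
    have b1 : ‖E1‖ ≤ e * (h * R) := a1.trans (by gcongr)
    have hrep : P (x + h • ξ) y - P (x + h • ξ) y₀ = G + h • dG + (E1 - E0) := by
      simp only [hE0, hE1, hG, hdG, add_sub_cancel_left, map_smul]; module
    rw [hrep]
    have hid : ⟪G + h • dG + (E1 - E0), ξ - h • s⟫ - ⟪G, ξ⟫ - h * (⟪dG, ξ⟫ - ⟪s, G⟫)
        = ⟪E1 - E0, ξ - h • s⟫ - h * h * ⟪dG, s⟫ := by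
      rw [inner_add_left (G + h • dG)]
      simp only [inner_add_left, inner_sub_right, inner_smul_left, inner_smul_right, real_inner_comm s G]
      simp only [conj_trivial]
      ring
    rw [hid]
    have c1 : |⟪E1 - E0, ξ - h • s⟫| ≤ (e * (h * R) + e * (h * R)) * (R + S) := by
      refine (abs_real_inner_le_norm _ _).trans ?_
      have n1 : ‖E1 - E0‖ ≤ e * (h * R) + e * (h * R) := (norm_sub_le _ _).trans (add_le_add b1 b0)
      have n2 : ‖ξ - h • s‖ ≤ R + S := by
        refine (norm_sub_le _ _).trans (add_le_add hξR ?_)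
        rw [norm_smul, Real.norm_of_nonneg hh.le]
        nlinarith [norm_nonneg s]
      gcongr
    have c2 : |h * h * ⟪dG, s⟫| ≤ h * h * (M * R * S) := by
      rw [abs_mul, abs_of_pos (by positivity)]
      gcongr
      exact (abs_real_inner_le_norm _ _).trans (by gcongr)
    have c3 : (e * (h * R) + e * (h * R)) * (R + S) = ε / 2 * h := by
      rw [he]; field_simp; ring
    have c4 : h * (h * (M * R * S)) ≤ h * (ε / 2) := by
      gcongr
      rw [lt_div_iff₀ (by positivity)] at hl4
      nlinarith
    calc _ ≤ _ := abs_sub _ _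
      _ ≤ ε / 2 * h + h * (ε / 2) := by rw [← c3]; refine add_le_add c1 (c2.trans ?_); linarith
      _ = _ := by ring
end PData


namespace PData
variable {V : Type*} [NormedAddCommGroup V] [InnerProductSpace ℝ V] [FiniteDimensional ℝ V]
    {Ω Ωs : Set V} {P : V → V → V} {Px Py : V → V → V →L[ℝ] V}

theorem mono (D : PData Ω Ωs P Px Py) {x₀ ys ξ₀ : V} (hx₀ : x₀ ∈ Ω) (hys : ys ∈ Ωs) (hξ : ξ₀ ≠ 0) :
    ∃ (u : V) (κ r₀ : ℝ), 0 < κ ∧ 0 < r₀ ∧ ∀ r, r ≤ r₀ → 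
      Metric.closedBall x₀ r ⊆ Ω ∧ Metric.closedBall ys r ⊆ Ωs ∧
      ∀ x ∈ Metric.closedBall x₀ r, ∀ ξ ∈ Metric.closedBall ξ₀ r, ∀ y b b', b ≤ b' →
        y + b • u ∈ Metric.closedBall ys r → y + b' • u ∈ Metric.closedBall ys r →
        ⟪P x (y + b • u), ξ⟫ + κ * (b' - b) ≤ ⟪P x (y + b' • u), ξ⟫ := by
  obtain ⟨u, hu⟩ := (D.bij x₀ hx₀ ys hys).2 ξ₀
  have hκ : 0 < ‖ξ₀‖^2 / 2 := by positivity
  have hop : IsOpen (Ω ×ˢ Ωs) := D.oΩ.prod D.oΩs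
  have hc : ContinuousAt (fun p : V × V => Py p.1 p.2) (x₀, ys) :=
    D.cPy.continuousAt (hop.mem_nhds ⟨hx₀, hys⟩)
  have hF : ContinuousAt (fun p : (V × V) × V => ⟪Py p.1.1 p.1.2 u, p.2⟫) ((x₀, ys), ξ₀) := by
    have h1 : ContinuousAt (fun p : (V × V) × V => Py p.1.1 p.1.2) ((x₀, ys), ξ₀) :=
      ContinuousAt.comp (g := fun p : V × V => Py p.1 p.2) (f := fun p : (V × V) × V => p.1) hc
        continuousAt_fst
    exact (h1.clm_apply continuousAt_const).inner continuousAt_snd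
  have hev : ∀ᶠ p : (V × V) × V in 𝓝 ((x₀, ys), ξ₀), ‖ξ₀‖^2 / 2 < ⟪Py p.1.1 p.1.2 u, p.2⟫ ∧
      p.1 ∈ Ω ×ˢ Ωs := by
    refine (hF.eventually (lt_mem_nhds (a := ‖ξ₀‖^2/2) ?_)).and
      (continuousAt_fst.eventually (hop.mem_nhds (x := (x₀, ys)) ⟨hx₀, hys⟩))
    simp only [hu, real_inner_self_eq_norm_sq]; linarith
  obtain ⟨r₀, hr₀, hball⟩ := Metric.nhds_basis_closedBall.eventually_iff.1 hev
  have key : ∀ r ≤ r₀, ∀ x ∈ Metric.closedBall x₀ r, ∀ y ∈ Metric.closedBall ys r,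
    ∀ ξ ∈ Metric.closedBall ξ₀ r, ‖ξ₀‖^2 / 2 < ⟪Py x y u, ξ⟫ ∧ x ∈ Ω ∧ y ∈ Ωs := by
    intro r hr x hx y hy ξ hξ
    have := @hball ((x, y), ξ) (by
      rw [← closedBall_prod_same, ← closedBall_prod_same]
      exact ⟨⟨Metric.closedBall_subset_closedBall hr hx, Metric.closedBall_subset_closedBall hr hy⟩,
        Metric.closedBall_subset_closedBall hr hξ⟩)
    exact ⟨this.1, this.2.1, this.2.2⟩
  refine ⟨u, _, r₀, hκ, hr₀, fun r hr => ⟨fun x hx => ?_, fun y hy => ?_, ?_⟩⟩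
  · have h0 : 0 ≤ r := dist_nonneg.trans hx
    exact (key r hr x hx ys (Metric.mem_closedBall_self h0) ξ₀ (Metric.mem_closedBall_self h0)).2.1
  · have h0 : 0 ≤ r := dist_nonneg.trans hy
    exact (key r hr x₀ (Metric.mem_closedBall_self h0) y hy ξ₀ (Metric.mem_closedBall_self h0)).2.2
  · intro x hx ξ hξ y b b' hbb hb hb'
    have hin : ∀ a ∈ Icc b b', y + a • u ∈ Metric.closedBall ys r := by
      intro a ha
      have hconv : Convex ℝ {a : ℝ | y + a • u ∈ Metric.closedBall ys r} := by
        intro a1 h1 a2 h2 s t hs ht hst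
        have := (convex_closedBall ys r) h1 h2 hs ht hst
        simp only [mem_ofPred_eq]
        convert this using 1
        rw [smul_add, smul_add, smul_smul, smul_smul, smul_eq_mul, smul_eq_mul]
        have : y = s • y + t • y := by rw [← add_smul, hst, one_smul]
        nth_rw 1 [this]
        module
      exact hconv.ordConnected.out hb hb' ha
    have hd : ∀ a ∈ Icc b b', HasDerivAt (fun a : ℝ => ⟪P x (y + a • u), ξ⟫)
        ⟪Py x (y + a • u) u, ξ⟫ a := by
      intro a ha
      have hk := key r hr x hx _ (hin a ha) ξ hξ
      have h1 : HasDerivAt (fun a : ℝ => y + a • u) u a := by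
        simpa using ((hasDerivAt_id a).smul_const u).const_add y
      have h2 := (D.dPy hk.2.1 hk.2.2).comp_hasDerivAt a h1
      simpa using h2.inner ℝ (hasDerivAt_const a ξ)
    have := Convex.mul_sub_le_image_sub_of_le_deriv (convex_Icc b b')
      (f := fun a : ℝ => ⟪P x (y + a • u), ξ⟫) (C := ‖ξ₀‖^2/2)
      (fun a ha => (hd a ha).continuousAt.continuousWithinAt)
      (fun a ha => (hd a (interior_subset ha)).differentiableAt.differentiableWithinAt)
      (fun a ha => by
        rw [(hd a (interior_subset ha)).deriv]
        exact (key r hr x hx _ (hin a (interior_subset ha)) ξ hξ).1.le)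
      b (left_mem_Icc.2 hbb) b' (right_mem_Icc.2 hbb) hbb
    linarith

theorem prop_M (D : PData Ω Ωs P Px Py) {x₀ y₀ ys ξ₀ u : V} {r S T κ : ℝ} (hr : 0 < r)
    (hx : Metric.closedBall x₀ r ⊆ Ω)
    (hy0 : Metric.closedBall y₀ r ⊆ Ωs) (hy : Metric.closedBall ys r ⊆ Ωs) (hS : 0 ≤ S)
    (hT : 0 ≤ T) (hκ : 0 < κ)
    (hmono : ∀ x ∈ Metric.closedBall x₀ r, ∀ ξ ∈ Metric.closedBall ξ₀ r, ∀ y b b', b ≤ b' →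
        y + b • u ∈ Metric.closedBall ys r → y + b' • u ∈ Metric.closedBall ys r →
        ⟪P x (y + b • u), ξ⟫ + κ * (b' - b) ≤ ⟪P x (y + b' • u), ξ⟫)
    (σ : V × V → V) (hσ : ∀ z, ‖σ z‖ ≤ S)
    (hsub : ∀ x ∈ Metric.closedBall x₀ r, ∀ ξ ∈ Metric.closedBall ξ₀ r, ∀ y ∈ Ωs,
      ⟪P x y - P x y₀, ξ⟫ = 0 →
      ⟪σ (x, ξ), P x y - P x y₀⟫ ≤ ⟪Px x y ξ, ξ⟫ - ⟪Px x y₀ ξ, ξ⟫)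
    (hstay : ∀ m k : ℕ, k * hh m ≤ T → euler σ (hh m) (x₀, ξ₀) k ∈
      Metric.closedBall x₀ r ×ˢ Metric.closedBall ξ₀ r)
    (Z : ℝ → V × V) (hZ : ∀ t ≥ 0, Tendsto (fun m => euler σ (hh m) (x₀, ξ₀) (kk m t))
      (hyperfilter ℕ) (𝓝 (Z t))) 
    (y : V) (hyb : y ∈ Metric.closedBall ys (r / 2)) (h0 : 0 ≤ ⟪P x₀ y - P x₀ y₀, ξ₀⟫)
    (t : ℝ) (ht0 : 0 ≤ t) (htT : t ≤ T) : 0 ≤ ⟪P (Z t).1 y - P (Z t).1 y₀, (Z t).2⟫ := by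
  obtain ⟨L, hL0, hstep⟩ := D.step (ξ₀ := ξ₀) hr hx hy0 hy S hS
  set B := r / (2 * (‖u‖ + 1)) with hB
  have hB0 : 0 < B := by positivity
  have hin : ∀ b ∈ Icc (-B) B, y + b • u ∈ Metric.closedBall ys r := by
    intro b hb
    rw [mem_closedBall_iff_norm] at hyb ⊢
    have h1 : ‖b • u‖ ≤ r / 2 := by
      rw [norm_smul, Real.norm_eq_abs]
      calc |b| * ‖u‖ ≤ B * (‖u‖ + 1) := by
            gcongr
            · exact abs_le.2 hb
            · linarith
        _ = r / 2 := by rw [hB]; field_simp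
    calc ‖y + b • u - ys‖ = ‖(y - ys) + b • u‖ := by congr 1; abel
      _ ≤ r / 2 + r / 2 := (norm_add_le _ _).trans (add_le_add hyb h1)
      _ = r := by ring
  have hy00 : y₀ ∈ Ωs := hy0 (Metric.mem_closedBall_self hr.le)
  have hop : IsOpen (Ω ×ˢ Ωs) := D.oΩ.prod D.oΩs
  have hcP : ∀ x ∈ Ω, ∀ y ∈ Ωs, ContinuousAt (fun p : V × V => P p.1 p.2) (x, y) :=
    fun x hx y hy => D.cP.continuousAt (hop.mem_nhds ⟨hx, hy⟩)
  -- membership of the limit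
  have hZm : Z t ∈ Metric.closedBall x₀ r ×ˢ Metric.closedBall ξ₀ r := by
    refine (Metric.isClosed_closedBall.prod Metric.isClosed_closedBall).mem_of_tendsto (hZ t ht0)
      (Eventually.of_forall fun m => hstay m _ ((kk_le m ht0).trans htT))
  have hcont : ∀ b ∈ Icc (-B) B, ContinuousAt (fun p : (V × V) × ℝ =>
      ⟪P p.1.1 (y + p.2 • u) - P p.1.1 y₀, p.1.2⟫) (Z t, b) := by
    intro b hb
    have c1 : ContinuousAt (fun p : (V × V) × ℝ => P p.1.1 (y + p.2 • u)) (Z t, b) :=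
      ContinuousAt.comp (g := fun p : V × V => P p.1 p.2)
        (f := fun p : (V × V) × ℝ => (p.1.1, y + p.2 • u))
        (hcP _ (hx hZm.1) _ (hy (hin b hb))) (by fun_prop)
    have c2 : ContinuousAt (fun p : (V × V) × ℝ => P p.1.1 y₀) (Z t, b) :=
      ContinuousAt.comp (g := fun p : V × V => P p.1 p.2)
        (f := fun p : (V × V) × ℝ => (p.1.1, y₀))
        (hcP _ (hx hZm.1) _ hy00) (by fun_prop)
    exact (c1.sub c2).inner (by fun_prop)
  have main : ∀ ε > 0, t * ε / κ < B → 0 ≤ ⟪P (Z t).1 (y + (t * ε / κ) • u) - P (Z t).1 y₀, (Z t).2⟫ := by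
    intro ε hε hεB
    obtain ⟨h₀, hh₀, hst⟩ := hstep ε hε
    have hbm : t * ε / κ ∈ Icc (-B) B := ⟨by have : 0 ≤ t * ε / κ := by positivity
                                             linarith, hεB.le⟩
    have hlim : Tendsto (fun m => ⟪P (euler σ (hh m) (x₀, ξ₀) (kk m t)).1
        (y + (kk m t * (ε * hh m) / κ) • u) - P (euler σ (hh m) (x₀, ξ₀) (kk m t)).1 y₀,
          (euler σ (hh m) (x₀, ξ₀) (kk m t)).2⟫) (hyperfilter ℕ)
        (𝓝 ⟪P (Z t).1 (y + (t * ε / κ) • u) - P (Z t).1 y₀, (Z t).2⟫) := by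
      have hb : Tendsto (fun m => kk m t * (ε * hh m) / κ) (hyperfilter ℕ) (𝓝 (t * ε / κ)) := by
        have := (((kk_tendsto ht0).mul_const ε).div_const κ).mono_left Nat.hyperfilter_le_atTop
        refine this.congr fun m => ?_
        ring
      exact (hcont _ hbm).tendsto.comp ((hZ t ht0).prodMk_nhds hb)
    refine ge_of_tendsto hlim ?_
    have e1 : ∀ᶠ m in (hyperfilter ℕ : Filter ℕ), hh m < h₀ :=
      (hh_tendsto.eventually (gt_mem_nhds hh₀)).filter_mono Nat.hyperfilter_le_atTop
    have e2 : ∀ᶠ m in (hyperfilter ℕ : Filter ℕ), hh m < κ * B / (L + ε) :=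
      (hh_tendsto.eventually (gt_mem_nhds (by positivity))).filter_mono Nat.hyperfilter_le_atTop
    filter_upwards [e1, e2] with m hm1 hm2
    have hhp := hh_pos m
    have hks : ∀ k ≤ kk m t, euler σ (hh m) (x₀, ξ₀) k ∈
        Metric.closedBall x₀ r ×ˢ Metric.closedBall ξ₀ r := by
      intro k hk
      refine hstay m k (le_trans ?_ ((kk_le m ht0).trans htT))
      gcongr
    refine aux_discrete (fun k b => ⟪P (euler σ (hh m) (x₀, ξ₀) k).1
        (y + b • u) - P (euler σ (hh m) (x₀, ξ₀) k).1 y₀,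
          (euler σ (hh m) (x₀, ξ₀) k).2⟫) (kk m t) κ (L + ε) (hh m) ε B B hκ hhp hε.le hB0.le
          ?_ ?_ ?_ ?_ ?_ ?_ ?_ (kk m t) le_rfl
    · intro k hk b hb
      refine ContinuousAt.continuousWithinAt ?_
      have c1 : ContinuousAt (fun b : ℝ => P (euler σ (hh m) (x₀, ξ₀) k).1 (y + b • u)) b :=
        ContinuousAt.comp (g := fun p : V × V => P p.1 p.2)
        (f := fun b : ℝ => ((euler σ (hh m) (x₀, ξ₀) k).1, y + b • u))
        (hcP _ (hx (hks k hk).1) _ (hy (hin b hb))) (by fun_prop)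
      exact (c1.sub continuousAt_const).inner continuousAt_const
    · intro k hk b hb b' hb' hbb
      have := hmono _ (hks k hk).1 _ (hks k hk).2 y b b' hbb (hin b hb) (hin b' hb')
      simp only [inner_sub_left]
      linarith
    · intro k hk b hb
      have := hst (hh m) hhp hm1 _ _ (σ (euler σ (hh m) (x₀, ξ₀) k)) (y + b • u) (hks k hk.le).1
        (hks (k+1) hk).1 (hks k hk.le).2 (hσ _) (hin b hb)
      obtain ⟨a1, a2⟩ := this
      have a3 := (abs_le.1 a1).1
      have a4 := (abs_le.1 a2).1
      simp only [euler]
      have a5 := mul_le_mul_of_nonneg_left a3 hhp.le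
      linarith
    · intro k hk b hb hz
      have := hst (hh m) hhp hm1 _ _ (σ (euler σ (hh m) (x₀, ξ₀) k)) (y + b • u) (hks k hk.le).1
        (hks (k+1) hk).1 (hks k hk.le).2 (hσ _) (hin b hb)
      obtain ⟨a1, a2⟩ := this
      have a3 := hsub _ (hks k hk.le).1 _ (hks k hk.le).2 _ (hy (hin b hb)) hz
      have a4 := (abs_le.1 a2).1
      simp only [euler]
      have a5 := mul_nonneg hhp.le (sub_nonneg.2 a3)
      rw [Prod.mk.eta] at a5
      linarith
    · rw [lt_div_iff₀ (by positivity)] at hm2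
      linarith
    · refine le_trans ?_ hεB.le
      gcongr ?_ / κ
      have := kk_le m ht0
      nlinarith
    · simpa [euler] using h0
  -- let ε → 0
  have hc0 : Tendsto (fun ε : ℝ => ⟪P (Z t).1 (y + (t * ε / κ) • u) - P (Z t).1 y₀, (Z t).2⟫)
      (𝓝[>] 0) (𝓝 ⟪P (Z t).1 y - P (Z t).1 y₀, (Z t).2⟫) := by
    have hb : Tendsto (fun ε : ℝ => t * ε / κ) (𝓝[>] 0) (𝓝 0) := by
      have : ContinuousAt (fun ε : ℝ => t * ε / κ) 0 := by fun_prop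
      simpa using this.tendsto.mono_left nhdsWithin_le_nhds
    have := (hcont 0 ⟨by linarith, hB0.le⟩).tendsto.comp ((tendsto_const_nhds (x := Z t)).prodMk_nhds hb)
    simpa [Function.comp_def] using this
  refine ge_of_tendsto hc0 ?_
  have hev : ∀ᶠ ε : ℝ in 𝓝[>] 0, t * ε / κ < B := by
    have : ContinuousAt (fun ε : ℝ => t * ε / κ) 0 := by fun_prop
    exact (this.eventually (gt_mem_nhds (by simpa using hB0))).filter_mono nhdsWithin_le_nhds
  filter_upwards [hev, self_mem_nhdsWithin] with ε h1 h2
  exact main ε h2 h1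
end PData



theorem aux_pos {f : ℝ → ℝ} {d a : ℝ} (h : HasDerivWithinAt f d (Ici a) a) (h0 : f a = 0)
    (hd : 0 < d) : ∀ᶠ θ in 𝓝[>] a, 0 < f θ := by
  have h1 := (hasDerivWithinAt_iff_tendsto_slope' (by simp)).1 (h.mono Ioi_subset_Ici_self)
  filter_upwards [h1.eventually (lt_mem_nhds hd), self_mem_nhdsWithin] with θ h2 h3
  rw [slope_def_field, h0, sub_zero] at h2
  have h3 : a < θ := h3
  exact (div_pos_iff_of_pos_right (by linarith)).1 h2

theorem aux_nonneg {f : ℝ → ℝ} {d a : ℝ} (h : HasDerivWithinAt f d (Ici a) a) (h0 : f a = 0)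
    (hf : ∀ᶠ θ in 𝓝[>] a, 0 ≤ f θ) : 0 ≤ d := by
  by_contra hd
  push Not at hd
  have := aux_pos h.neg (by simp [h0]) (by linarith : 0 < -d)
  obtain ⟨θ, h1, h2⟩ := (this.and hf).exists
  simp only [Pi.neg_apply] at h1
  linarith

theorem aux_lin {V : Type*} [NormedAddCommGroup V] [InnerProductSpace ℝ V] {m m0 : V} (hm0 : m0 ≠ 0)
    (h : ∀ v, 0 < ⟪m0, v⟫ → 0 ≤ ⟪m, v⟫) : 0 ≤ ⟪m, m0⟫ / ‖m0‖^2 ∧ m = (⟪m, m0⟫ / ‖m0‖^2) • m0 := by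
  have hp : 0 < ‖m0‖^2 := by positivity
  have h1 : 0 ≤ ⟪m, m0⟫ := h m0 (by rw [real_inner_self_eq_norm_sq]; exact hp)
  refine ⟨by positivity, ?_⟩
  set l := ⟪m, m0⟫ / ‖m0‖^2 with hl
  set d := m - l • m0 with hd
  have hd0 : ⟪m0, d⟫ = 0 := by
    rw [hd, inner_sub_right, inner_smul_right, real_inner_self_eq_norm_sq, real_inner_comm, hl]
    field_simp; ring
  have hmd : ⟪m, d⟫ = ‖d‖^2 := by
    have : m = d + l • m0 := by rw [hd]; abel
    rw [this, inner_add_left, inner_smul_left, hd0, ← real_inner_self_eq_norm_sq]; simp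
  have key : ∀ ε > 0, ‖d‖^2 ≤ ε * ⟪m, m0⟫ := by
    intro ε hε
    have := h (ε • m0 - d) (by
      rw [inner_sub_right, inner_smul_right, hd0, real_inner_self_eq_norm_sq, sub_zero]; positivity)
    rw [inner_sub_right, inner_smul_right, hmd] at this
    linarith
  have hle : ‖d‖^2 ≤ 0 := by
    have : Tendsto (fun ε : ℝ => ε * ⟪m, m0⟫) (𝓝[>] 0) (𝓝 0) := by
      have : ContinuousAt (fun ε : ℝ => ε * ⟪m, m0⟫) 0 := by fun_prop
      simpa using this.tendsto.mono_left nhdsWithin_le_nhds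
    refine ge_of_tendsto this ?_
    filter_upwards [self_mem_nhdsWithin] with ε hε using key ε hε
  have : d = 0 := by
    have : ‖d‖ = 0 := by nlinarith [norm_nonneg d]
    exact norm_eq_zero.1 this
  exact sub_eq_zero.1 this

namespace PData
variable {V : Type*} [NormedAddCommGroup V] [InnerProductSpace ℝ V] [FiniteDimensional ℝ V]
    {Ω Ωs : Set V} {P : V → V → V} {Px Py : V → V → V →L[ℝ] V}

open Classical in
theorem curve (D : PData Ω Ωs P Px Py) {x₀ y₀ y₁ ξ₀ : V} (hx₀ : x₀ ∈ Ω) (hy₀ : y₀ ∈ Ωs)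
    (hy₁ : y₁ ∈ Ωs) (hξ : ξ₀ ≠ 0) (h0 : 0 ≤ ⟪P x₀ y₁ - P x₀ y₀, ξ₀⟫) :
    ∃ T > 0, ∃ S : ℝ, 0 ≤ S ∧ ∃ Z : ℝ → V × V, Z 0 = (x₀, ξ₀) ∧
      (∀ t ∈ Icc 0 T, (Z t).1 ∈ Ω ∧ (Z t).2 ≠ 0 ∧ 0 ≤ ⟪P (Z t).1 y₁ - P (Z t).1 y₀, (Z t).2⟫) ∧
      (∀ t t', 0 ≤ t → t ≤ t' → ‖(Z t').2 - (Z t).2‖ ≤ S * (t' - t)) ∧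
      (∀ t t', 0 ≤ t → t ≤ t' → ‖(Z t').1 - (Z t).1 - (t' - t) • (Z t).2‖ ≤ S * (t' - t)^2) ∧
      ∃ ρ > 0, ∀ y ∈ Metric.closedBall y₀ ρ, 0 ≤ ⟪P x₀ y - P x₀ y₀, ξ₀⟫ → ∀ t ∈ Icc 0 T,
        0 ≤ ⟪P (Z t).1 y - P (Z t).1 y₀, (Z t).2⟫ := by
  obtain ⟨u0, κ0, r0, hκ0, hr0, hm0⟩ := D.mono hx₀ hy₀ hξ
  obtain ⟨u1, κ1, r1, hκ1, hr1, hm1⟩ := D.mono hx₀ hy₁ hξ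
  obtain ⟨r2, hr2, S, hS, -, hsg⟩ := D.subgrad hx₀ hy₀ (‖ξ₀‖ + 1)
  have hξ0 : 0 < ‖ξ₀‖ := norm_pos_iff.2 hξ
  obtain ⟨r, hr, hra, hrb, hrc, hrd, hre⟩ : ∃ r > 0, r ≤ r0 ∧ r ≤ r1 ∧ r ≤ r2 / 2 ∧ r ≤ 1 ∧ r ≤ ‖ξ₀‖/2 := by
    refine ⟨min r0 (min r1 (min (r2/2) (min 1 (‖ξ₀‖/2)))), by positivity, ?_⟩
    simp
  obtain ⟨hxΩ, hy0Ω, hmo0⟩ := hm0 r hra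
  obtain ⟨-, hy1Ω, hmo1⟩ := hm1 r hrb
  have hex : ∀ z : V × V, z ∈ Metric.closedBall x₀ r ×ˢ Metric.closedBall ξ₀ r →
      ∃ s : V, ‖s‖ ≤ S ∧ ∀ y ∈ Ωs, ⟪P z.1 y - P z.1 y₀, z.2⟫ = 0 →
        ⟪s, P z.1 y - P z.1 y₀⟫ ≤ ⟪Px z.1 y z.2, z.2⟫ - ⟪Px z.1 y₀ z.2, z.2⟫ := by
    intro z hz
    refine hsg z.1 ?_ z.2 ?_
    · have := hz.1
      rw [Metric.mem_closedBall] at this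
      rw [Metric.mem_ball]; linarith
    · have h1 := hz.2
      rw [mem_closedBall_iff_norm] at h1
      have := norm_le_norm_add_norm_sub' z.2 ξ₀
      linarith
  choose σ' hσ1 hσ2 using hex
  set σ : V × V → V := fun z => if hz : z ∈ Metric.closedBall x₀ r ×ˢ Metric.closedBall ξ₀ r then σ' z hz else 0 with hσdef
  have hσ : ∀ z, ‖σ z‖ ≤ S := by
    intro z
    by_cases hz : z ∈ Metric.closedBall x₀ r ×ˢ Metric.closedBall ξ₀ r
    · simp only [hσdef, dif_pos hz]; exact hσ1 z hz
    · simp only [hσdef, dif_neg hz]; simpa using hS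
  have hsub : ∀ x ∈ Metric.closedBall x₀ r, ∀ ξ ∈ Metric.closedBall ξ₀ r, ∀ y ∈ Ωs,
      ⟪P x y - P x y₀, ξ⟫ = 0 →
      ⟪σ (x, ξ), P x y - P x y₀⟫ ≤ ⟪Px x y ξ, ξ⟫ - ⟪Px x y₀ ξ, ξ⟫ := by
    intro x hx ξ hξ y hy hz
    have hm : (x, ξ) ∈ Metric.closedBall x₀ r ×ˢ Metric.closedBall ξ₀ r := ⟨hx, hξ⟩
    simp only [hσdef, dif_pos hm]
    exact hσ2 (x, ξ) hm y hy hz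
  obtain ⟨T, hT, hT1, hT2⟩ : ∃ T > 0, T ≤ 1 ∧ T * (‖ξ₀‖ + S + 1) ≤ r := by
    refine ⟨min 1 (r / (‖ξ₀‖ + S + 1)), by positivity, min_le_left _ _, ?_⟩
    rw [← le_div_iff₀ (by positivity)]
    exact min_le_right _ _
  have hstay : ∀ m k : ℕ, k * hh m ≤ T → euler σ (hh m) (x₀, ξ₀) k ∈
      Metric.closedBall x₀ r ×ˢ Metric.closedBall ξ₀ r := by
    intro m k hk
    have h1 := euler_xi σ S (hh m) (hh_pos m).le hσ (x₀, ξ₀) 0 k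
    have h2 := euler_x σ S (hh m) (hh_pos m).le hσ (x₀, ξ₀) 0 k
    have h4 : 0 ≤ k * hh m := by have := hh_pos m; positivity
    rw [zero_add] at h1 h2
    simp only [euler] at h1 h2
    constructor
    · rw [mem_closedBall_iff_norm]
      calc _ = ‖((euler σ (hh m) (x₀, ξ₀) k).1 - x₀ - (k * hh m) • ξ₀) + (k * hh m) • ξ₀‖ := by
            congr 1; abel
        _ ≤ S * (k * hh m)^2 + (k * hh m) * ‖ξ₀‖ := by
            refine (norm_add_le _ _).trans (add_le_add h2 ?_)
            rw [norm_smul, Real.norm_of_nonneg h4]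
        _ ≤ S * T^2 + T * ‖ξ₀‖ := by gcongr
        _ ≤ S * T + T * ‖ξ₀‖ := by gcongr; nlinarith
        _ ≤ r := by linarith
    · rw [mem_closedBall_iff_norm]
      refine h1.trans ?_
      have : S * (k * hh m) ≤ S * T := by gcongr
      nlinarith
  obtain ⟨Z, hZ0, hZ, hZ2, hZ1⟩ := euler_limit σ S hσ (x₀, ξ₀)
  have hZm : ∀ t ∈ Icc 0 T, Z t ∈ Metric.closedBall x₀ r ×ˢ Metric.closedBall ξ₀ r := by
    intro t ht
    refine (Metric.isClosed_closedBall.prod Metric.isClosed_closedBall).mem_of_tendsto (hZ t ht.1)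
      (Eventually.of_forall fun m => hstay m _ ((kk_le m ht.1).trans ht.2))
  refine ⟨T, hT, S, hS, Z, hZ0, fun t ht => ⟨hxΩ (hZm t ht).1, ?_, ?_⟩, hZ2, hZ1, r / 2, by positivity,
    fun y hy hy' t ht => ?_⟩
  · intro hz
    have := (hZm t ht).2
    rw [hz, mem_closedBall_iff_norm, zero_sub, norm_neg] at this
    linarith
  · exact D.prop_M hr hxΩ hy0Ω hy1Ω hS hT.le hκ1 hmo1 σ hσ hsub hstay Z hZ y₁
      (Metric.mem_closedBall_self (by positivity)) h0 t ht.1 ht.2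
  · exact D.prop_M hr hxΩ hy0Ω hy0Ω hS hT.le hκ0 hmo0 σ hσ hsub hstay Z hZ y hy hy' t ht.1 ht.2

theorem core (D : PData Ω Ωs P Px Py) {x₀ y₀ y₁ ξ₀ : V} (hx₀ : x₀ ∈ Ω) (hy₀ : y₀ ∈ Ωs)
    (hy₁ : y₁ ∈ Ωs) (hξ : ξ₀ ≠ 0) (h0 : 0 ≤ ⟪P x₀ y₁ - P x₀ y₀, ξ₀⟫)
    (q : V → V) (Dq : V → V →L[ℝ] V) (hq : ∀ x ∈ Ω, HasFDerivAt q (Dq x) x)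
    (hsym : ∀ x ∈ Ω, ∀ ξ v, ⟪Dq x ξ, v⟫ = ⟪Py x y₀ v, ξ⟫) :
    ∃ δ : ℝ, 0 < δ ∧ ∀ τ ∈ Icc 0 δ, ∃ x ∈ Ω, ∃ ξ, q x = q x₀ + τ • Dq x₀ ξ₀ ∧ Dq x ξ = Dq x₀ ξ₀ ∧
      0 ≤ ⟪P x y₁ - P x y₀, ξ⟫ := by
  obtain ⟨T, hT, S, hS, Z, hZ0, hZ, hZ2, hZ1, ρ, hρ, hM⟩ := D.curve hx₀ hy₀ hy₁ hξ h0
  have hne : ∀ x ∈ Ω, ∀ ξ, ξ ≠ 0 → Dq x ξ ≠ 0 := by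
    intro x hx ξ hξ h
    obtain ⟨v, hv⟩ := (D.bij x hx y₀ hy₀).2 ξ
    have := hsym x hx ξ v
    rw [h, hv, inner_zero_left, real_inner_self_eq_norm_sq] at this
    have h2 : 0 < ‖ξ‖^2 := by positivity
    linarith
  set m0 := Dq x₀ ξ₀ with hm0
  have hm00 : m0 ≠ 0 := hne _ hx₀ _ hξ
  have hp : 0 < ‖m0‖^2 := by positivity
  have hder : ∀ x ∈ Ω, ∀ ξ v, HasDerivAt (fun θ : ℝ => ⟪P x (y₀ + θ • v) - P x y₀, ξ⟫)
      ⟪Dq x ξ, v⟫ 0 := by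
    intro x hx ξ v
    rw [hsym x hx]
    have h1 : HasDerivAt (fun a : ℝ => y₀ + a • v) v 0 := by
      simpa using ((hasDerivAt_id (0:ℝ)).smul_const v).const_add y₀
    have h2 := (show HasFDerivAt (fun y => P x y) (Py x y₀) (y₀ + (0:ℝ) • v) by
      simpa using D.dPy hx hy₀).comp_hasDerivAt (0:ℝ) h1
    simpa using (h2.sub_const (P x y₀)).inner ℝ (hasDerivAt_const (0:ℝ) ξ)
  have hA : ∀ t ∈ Icc 0 T, ∀ v, 0 < ⟪m0, v⟫ → 0 ≤ ⟪Dq (Z t).1 (Z t).2, v⟫ := by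
    intro t ht v hv
    have e1 := aux_pos (hder x₀ hx₀ ξ₀ v).hasDerivWithinAt (by simp) hv
    refine aux_nonneg (hder _ (hZ t ht).1 (Z t).2 v).hasDerivWithinAt (by simp) ?_
    have e2 : ∀ᶠ θ : ℝ in 𝓝[>] 0, y₀ + θ • v ∈ Metric.closedBall y₀ ρ := by
      have : ContinuousAt (fun θ : ℝ => y₀ + θ • v) 0 := by fun_prop
      exact (this.eventually (by simp only [zero_smul, add_zero]; exact Metric.closedBall_mem_nhds y₀ hρ)).filter_mono
        nhdsWithin_le_nhds
    filter_upwards [e1, e2] with θ h1 h2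
    exact hM _ h2 h1.le t ht
  have hB := fun t ht => aux_lin hm00 (hA t ht)
  have hxd : ∀ t ∈ Icc 0 T, HasDerivWithinAt (fun t => (Z t).1) (Z t).2 (Ici t) t := by
    intro t ht
    rw [hasDerivWithinAt_iff_isLittleO, Asymptotics.isLittleO_iff]
    intro e he
    have : ∀ᶠ t' in 𝓝 t, S * |t' - t| < e := by
      have : ContinuousAt (fun t' => S * |t' - t|) t := by fun_prop
      exact this.eventually (gt_mem_nhds (by simpa using he))
    filter_upwards [this.filter_mono nhdsWithin_le_nhds, self_mem_nhdsWithin] with t' h1 h2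
    have h2 : t ≤ t' := h2
    refine (hZ1 t t' ht.1 h2).trans ?_
    rw [Real.norm_eq_abs]
    rw [abs_of_nonneg (sub_nonneg.2 h2)] at *
    nlinarith [sub_nonneg.2 h2]
  have hxc : ContinuousOn (fun t => (Z t).1) (Icc 0 T) := by
    set K := ‖ξ₀‖ + S * T + S * T with hK
    have hle : ∀ s ∈ Icc 0 T, ∀ t ∈ Icc 0 T, s ≤ t → ‖(Z t).1 - (Z s).1‖ ≤ K * (t - s) := by
      intro s hs t ht hst
      have h1 := hZ1 s t hs.1 hst
      have h2 := hZ2 0 s le_rfl hs.1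
      rw [hZ0, sub_zero] at h2
      have h3 : ‖(Z s).2‖ ≤ ‖ξ₀‖ + S * T := by
        have := norm_le_norm_add_norm_sub' (Z s).2 ξ₀
        have : S * s ≤ S * T := by gcongr; exact hs.2
        simp only at h2
        linarith
      calc ‖(Z t).1 - (Z s).1‖ = ‖((Z t).1 - (Z s).1 - (t - s) • (Z s).2) + (t - s) • (Z s).2‖ := by
            congr 1; abel
        _ ≤ S * (t - s)^2 + (t - s) * (‖ξ₀‖ + S * T) := by
            refine (norm_add_le _ _).trans (add_le_add h1 ?_)
            rw [norm_smul, Real.norm_of_nonneg (sub_nonneg.2 hst)]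
            gcongr
        _ ≤ K * (t - s) := by
            have : S * (t-s) * (t - s) ≤ S * T * (t - s) := by
              have := sub_nonneg.2 hst
              gcongr
              linarith [hs.1, ht.2]
            rw [hK]; nlinarith
    have : LipschitzOnWith K.toNNReal (fun t => (Z t).1) (Icc 0 T) := by
      refine LipschitzOnWith.of_dist_le_mul fun s hs t ht => ?_
      rw [Real.coe_toNNReal _ (by positivity), dist_eq_norm, Real.dist_eq]
      rcases le_total s t with h | h
      · have := hle s hs t ht h
        rw [norm_sub_rev, abs_sub_comm, abs_of_nonneg (sub_nonneg.2 h)]; exact this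
      · have := hle t ht s hs h
        rw [abs_of_nonneg (sub_nonneg.2 h)]; exact this
    exact this.continuousOn
  have hqd : ∀ t ∈ Icc 0 T, HasDerivWithinAt (fun t => q (Z t).1) (Dq (Z t).1 (Z t).2) (Ici t) t :=
    fun t ht => (hq _ (hZ t ht).1).comp_hasDerivWithinAt t (hxd t ht)
  have hqc : ContinuousOn (fun t => q (Z t).1) (Icc 0 T) := by
    have : ContinuousOn q Ω := fun x hx => (hq x hx).continuousAt.continuousWithinAt
    exact this.comp hxc fun t ht => (hZ t ht).1
  set τ : ℝ → ℝ := fun t => ⟪q (Z t).1 - q x₀, m0⟫ / ‖m0‖^2 with hτ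
  have hτd : ∀ t ∈ Icc 0 T, HasDerivWithinAt τ (⟪Dq (Z t).1 (Z t).2, m0⟫ / ‖m0‖^2) (Ici t) t := by
    intro t ht
    have := (((hqd t ht).sub_const (q x₀)).inner ℝ (hasDerivWithinAt_const t (Ici t) m0)).div_const (‖m0‖^2)
    simpa using this
  have hτc : ContinuousOn τ (Icc 0 T) :=
    ((hqc.sub continuousOn_const).inner continuousOn_const).div_const _
  have hconst := constant_of_has_deriv_right_zero (f := fun t => q (Z t).1 - q x₀ - τ t • m0)
    (a := 0) (b := T) ((hqc.sub continuousOn_const).sub (hτc.smul continuousOn_const)) (by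
      intro t ht
      have ht' : t ∈ Icc 0 T := ⟨ht.1, ht.2.le⟩
      have := ((hqd t ht').sub_const (q x₀)).sub ((hτd t ht').smul_const m0)
      rwa [← (hB t ht').2, sub_self] at this)
  have hτ0 : τ 0 = 0 := by simp [hτ, hZ0]
  have h0T : (0:ℝ) ∈ Icc 0 T := ⟨le_rfl, hT.le⟩
  have hpos : ∀ᶠ t in 𝓝[>] (0:ℝ), 0 < τ t := by
    refine aux_pos (hτd 0 h0T) hτ0 ?_
    rw [hZ0, ← hm0, real_inner_self_eq_norm_sq]
    positivity
  obtain ⟨T', hT'1, hT'2⟩ := (hpos.and (Ioc_mem_nhdsGT hT)).exists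
  refine ⟨τ T', hT'1, fun a ha => ?_⟩
  obtain ⟨t, ht, hta⟩ := intermediate_value_Icc hT'2.1.le
    (hτc.mono (Icc_subset_Icc le_rfl hT'2.2)) (by rwa [hτ0] : a ∈ Icc (τ 0) (τ T'))
  have htT : t ∈ Icc 0 T := ⟨ht.1, ht.2.trans hT'2.2⟩
  obtain ⟨hz1, hz2, hz3⟩ := hZ t htT
  obtain ⟨hl0, hl⟩ := hB t htT
  set l := ⟪Dq (Z t).1 (Z t).2, m0⟫ / ‖m0‖^2
  have hlpos : 0 < l := by
    refine lt_of_le_of_ne hl0 fun h => hne _ hz1 _ hz2 ?_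
    rw [hl, ← h, zero_smul]
  refine ⟨(Z t).1, hz1, l⁻¹ • (Z t).2, ?_, ?_, ?_⟩
  · have := hconst t htT
    simp only [hZ0, hτ0, hta] at this
    simp only [sub_self, zero_smul] at this
    rw [sub_eq_zero] at this
    rw [← this]; abel
  · rw [map_smul, hl, smul_smul, inv_mul_cancel₀ hlpos.ne', one_smul]
  · rw [inner_smul_right]; positivity
end PData


namespace PData
variable {V : Type*} [NormedAddCommGroup V] [InnerProductSpace ℝ V] [FiniteDimensional ℝ V]
    {Ω Ωs : Set V} {P : V → V → V} {Px Py : V → V → V →L[ℝ] V}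

theorem final (D : PData Ω Ωs P Px Py) {y₀ y₁ : V} (hy₀ : y₀ ∈ Ωs) (hy₁ : y₁ ∈ Ωs)
    (q : V → V) (Dq : V → V →L[ℝ] V) (hq : ∀ x ∈ Ω, HasFDerivAt q (Dq x) x)
    (hsym : ∀ x ∈ Ω, ∀ ξ v, ⟪Dq x ξ, v⟫ = ⟪Py x y₀ v, ξ⟫)
    (cDq : ContinuousOn Dq Ω) (injq : InjOn q Ω) (cvxq : Convex ℝ (q '' Ω))
    (g : V → ℝ) (hg : ∀ x ∈ Ω, HasFDerivAt g (innerSL ℝ (P x y₁ - P x y₀)) x) (σ : ℝ) :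
    Convex ℝ (q '' {x ∈ Ω | g x ≤ σ}) := by
  have hinj : ∀ x ∈ Ω, Function.Injective (Dq x) := by
    intro x hx
    rw [injective_iff_map_eq_zero]
    intro ξ h
    obtain ⟨v, hv⟩ := (D.bij x hx y₀ hy₀).2 ξ
    have := hsym x hx ξ v
    rw [h, hv, inner_zero_left] at this
    exact inner_self_eq_zero.1 this.symm
  have heq : ∀ x ∈ Ω, ∃ e : V ≃L[ℝ] V, (e : V →L[ℝ] V) = Dq x := by
    intro x hx
    refine ⟨(LinearEquiv.ofInjectiveEndo (Dq x : V →ₗ[ℝ] V) (hinj x hx)).toContinuousLinearEquiv, ?_⟩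
    refine ContinuousLinearMap.ext fun v => ?_
    simp
  set X : V → V := fun p => Function.invFunOn q Ω p with hX
  have hXq : ∀ x ∈ Ω, X (q x) = x := fun x hx => injq.leftInvOn_invFunOn hx
  have hXd : ∀ x ∈ Ω, HasFDerivAt X (Dq x).inverse (q x) := by
    intro x hx
    obtain ⟨e, he⟩ := heq x hx
    have hs : HasStrictFDerivAt q (e : V →L[ℝ] V) x := by
      rw [he]
      refine hasStrictFDerivAt_of_hasFDerivAt_of_continuousAt (x := x) (f' := Dq) ?_
        (cDq.continuousAt (D.oΩ.mem_nhds hx))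
      filter_upwards [D.oΩ.mem_nhds hx] with z hz using hq z hz
    have h1 := hs.to_localInverse
    have h2 := h1.continuousAt
    have h3 : hs.localInverse q e x (q x) = x := hs.localInverse_apply_image
    rw [← he, ContinuousLinearMap.inverse_equiv]
    refine h1.hasFDerivAt.congr_of_eventuallyEq ?_
    have h4 := hs.eventually_right_inverse
    have h5 : ∀ᶠ p in 𝓝 (q x), hs.localInverse q e x p ∈ Ω :=
      h2.eventually (by rw [h3]; exact D.oΩ.mem_nhds hx)
    filter_upwards [h4, h5] with p h4 h5
    conv_lhs => rw [← h4]
    exact hXq _ h5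
  rintro _ ⟨a, ⟨ha, hga⟩, rfl⟩ _ ⟨b, ⟨hb, hgb⟩, rfl⟩ s₀ t₀ hs₀ ht₀ hst
  set v := q b - q a with hv
  by_cases hv0 : v = 0
  · have : q b = q a := sub_eq_zero.1 hv0
    rw [this, ← add_smul, hst, one_smul]
    exact ⟨a, ⟨ha, hga⟩, rfl⟩
  set p : ℝ → V := fun t => q a + t • v with hp
  have hpm : ∀ t ∈ Icc (0:ℝ) 1, p t ∈ q '' Ω := by
    intro t ht
    have := cvxq (mem_image_of_mem q ha) (mem_image_of_mem q hb) (sub_nonneg.2 ht.2) ht.1 (by ring)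
    convert this using 1
    simp only [hp, hv]; module
  have hXm : ∀ t ∈ Icc (0:ℝ) 1, X (p t) ∈ Ω ∧ q (X (p t)) = p t := by
    intro t ht
    obtain ⟨x, hx, hxp⟩ := hpm t ht
    rw [← hxp, hXq x hx]; exact ⟨hx, rfl⟩
  have hpt : s₀ • q a + t₀ • q b = p t₀ := by
    have : s₀ = 1 - t₀ := by linarith
    rw [this]; simp only [hp, hv]; module
  have ht1 : t₀ ∈ Icc (0:ℝ) 1 := ⟨ht₀, by linarith⟩
  rw [hpt]
  refine ⟨X (p t₀), ⟨(hXm t₀ ht1).1, ?_⟩, (hXm t₀ ht1).2⟩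
  set W : ℝ → ℝ := fun t => ⟪P (X (p t)) y₁ - P (X (p t)) y₀, (Dq (X (p t))).inverse v⟫ with hW
  have hpd : ∀ t, HasDerivAt p v t := fun t => by
    have := ((hasDerivAt_id t).smul_const v).const_add (q a)
    rw [one_smul] at this
    exact this
  have hXpd : ∀ t ∈ Icc (0:ℝ) 1, HasDerivAt (fun t => X (p t)) ((Dq (X (p t))).inverse v) t := by
    intro t ht
    have h1 := hXd _ (hXm t ht).1
    rw [(hXm t ht).2] at h1
    exact h1.comp_hasDerivAt t (hpd t)
  have hφ : ∀ t ∈ Icc (0:ℝ) 1, HasDerivAt (fun t => g (X (p t))) (W t) t := by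
    intro t ht
    have := (hg _ (hXm t ht).1).comp_hasDerivAt t (hXpd t ht)
    exact this
  have hWc : ContinuousOn W (Icc 0 1) := by
    intro t ht
    refine ContinuousAt.continuousWithinAt ?_
    have hxm := (hXm t ht).1
    have c0 : ContinuousAt (fun t => X (p t)) t := (hXpd t ht).continuousAt
    have c1 : ∀ y ∈ Ωs, ContinuousAt (fun t => P (X (p t)) y) t := fun y hy =>
      ContinuousAt.comp (g := fun x => P x y) (D.dPx hxm hy).continuousAt c0
    obtain ⟨e, he⟩ := heq _ hxm
    have c2 : ContinuousAt (fun t => Dq (X (p t))) t :=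
      ContinuousAt.comp (g := Dq) (cDq.continuousAt (D.oΩ.mem_nhds hxm)) c0
    have c3 : ContinuousAt (fun t => (Dq (X (p t))).inverse) t := by
      refine ContinuousAt.comp (g := ContinuousLinearMap.inverse) ?_ c2
      rw [← he]
      exact (contDiffAt_map_inverse (𝕜 := ℝ) (n := 1) e).continuousAt
    exact ((c1 y₁ hy₁).sub (c1 y₀ hy₀)).inner (c3.clm_apply continuousAt_const)
  have hprop : ∀ s ∈ Icc (0:ℝ) 1, 0 ≤ W s → ∀ t ∈ Icc s 1, 0 ≤ W t := by
    intro s hs hWs t ht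
    have hsub : Icc s 1 ⊆ Icc (0:ℝ) 1 := Icc_subset_Icc hs.1 le_rfl
    have hcl : IsClosed ({t | 0 ≤ W t} ∩ Icc s 1) := by
      have := (hWc.mono hsub).preimage_isClosed_of_isClosed isClosed_Icc (isClosed_Ici (a := (0:ℝ)))
      rw [inter_comm]; exact this
    refine hcl.Icc_subset_of_forall_exists_gt hWs ?_ ht
    rintro z ⟨hz1, hz2⟩ y hy
    have hz1 : 0 ≤ W z := hz1
    have hz01 : z ∈ Icc (0:ℝ) 1 := hsub ⟨hz2.1, hz2.2.le⟩
    obtain ⟨hxm, hxq⟩ := hXm z hz01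
    obtain ⟨e, he⟩ := heq _ hxm
    have hinv : ∀ x ∈ Ω, ∀ ξ, Dq x ξ = v → (Dq x).inverse v = ξ := by
      intro x hx ξ h
      obtain ⟨e, he⟩ := heq x hx
      rw [← he, ContinuousLinearMap.inverse_equiv, ← h, ← he]; simp
    have hDv : Dq (X (p z)) ((Dq (X (p z))).inverse v) = v := by
      rw [← he, ContinuousLinearMap.inverse_equiv]; simp
    obtain ⟨δ, hδ, hc⟩ := D.core hxm hy₀ hy₁ (ξ₀ := (Dq (X (p z))).inverse v) (by
      intro h; rw [h, map_zero] at hDv; exact hv0 hDv.symm) hz1 q Dq hq hsym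
    have hy : z < y := hy
    set τ := min δ (min (y - z) (1 - z)) with hτ
    have hz2' := hz2.2
    have hτ0 : 0 < τ := by
      have := sub_pos.2 hy
      have := sub_pos.2 hz2'
      positivity
    have t1 : τ ≤ y - z := (min_le_right _ _).trans (min_le_left _ _)
    have t2 : τ ≤ 1 - z := (min_le_right _ _).trans (min_le_right _ _)
    obtain ⟨x, hx, ξ, h1, h2, h3⟩ := hc τ ⟨hτ0.le, min_le_left _ _⟩
    rw [hDv, hxq] at h1
    rw [hDv] at h2
    have hpx : q x = p (z + τ) := by rw [h1]; simp only [hp]; module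
    have hxe : X (p (z + τ)) = x := by rw [← hpx, hXq x hx]
    refine ⟨z + τ, ?_, by linarith, by linarith⟩
    change 0 ≤ W (z + τ)
    simp only [hW, hxe, hinv x hx ξ h2]
    exact h3
  by_contra hcon
  push Not at hcon
  have hX0 : X (p 0) = a := by
    have : p 0 = q a := by simp [hp]
    rw [this, hXq a ha]
  have hX1 : X (p 1) = b := by
    have : p 1 = q b := by simp [hp, hv]
    rw [this, hXq b hb]
  have ht0 : 0 < t₀ := by
    refine lt_of_le_of_ne ht₀ fun h => ?_
    rw [← h, hX0] at hcon; linarith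
  have hφc : ContinuousOn (fun t => g (X (p t))) (Icc 0 1) :=
    fun t ht => (hφ t ht).continuousAt.continuousWithinAt
  obtain ⟨s, hs, hsW⟩ := exists_hasDerivAt_eq_slope (fun t => g (X (p t))) W ht0
    (hφc.mono (Icc_subset_Icc le_rfl ht1.2)) (fun t ht => hφ t ⟨ht.1.le, ht.2.le.trans ht1.2⟩)
  have hWs : 0 ≤ W s := by
    rw [hsW, hX0]
    apply div_nonneg <;> linarith
  have hs01 : s ∈ Icc (0:ℝ) 1 := ⟨hs.1.le, hs.2.le.trans ht1.2⟩
  have hpr := hprop s hs01 hWs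
  have hmono : MonotoneOn (fun t => g (X (p t))) (Icc s 1) := by
    have hsub : Icc s 1 ⊆ Icc (0:ℝ) 1 := Icc_subset_Icc hs01.1 le_rfl
    refine monotoneOn_of_deriv_nonneg (convex_Icc s 1) (hφc.mono hsub)
      (fun t ht => (hφ t (hsub (interior_subset ht))).differentiableAt.differentiableWithinAt)
      (fun t ht => ?_)
    rw [(hφ t (hsub (interior_subset ht))).deriv]
    exact hpr t (interior_subset ht)
  have := hmono ⟨hs.2.le, ht1.2⟩ ⟨hs01.2, le_rfl⟩ ht1.2
  simp only [hX1] at this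
  linarith
end PData



theorem taylor2 {h h' : ℝ → ℝ} {H : ℝ} (h0 : h 0 = 0) (hd : ∀ᶠ τ in 𝓝 (0:ℝ), HasDerivAt h (h' τ) τ)
    (hd' : HasDerivAt h' H 0) :
    Tendsto (fun τ => (h τ - h' 0 * τ) / τ^2) (𝓝[>] 0) (𝓝 (H / 2)) := by
  refine HasDerivAt.lhopital_zero_nhdsGT (f' := fun τ => h' τ - h' 0) (g' := fun τ => 2 * τ)
    ?_ ?_ ?_ ?_ ?_ ?_
  · filter_upwards [hd.filter_mono nhdsWithin_le_nhds] with τ hτ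
    have := hτ.sub ((hasDerivAt_id τ).const_mul (h' 0))
    rw [mul_one] at this
    exact this
  · refine Eventually.of_forall fun τ => ?_
    simpa using hasDerivAt_pow 2 τ
  · filter_upwards [self_mem_nhdsWithin] with τ hτ
    have : 0 < τ := hτ
    positivity
  · have : ContinuousAt (fun τ => h τ - h' 0 * τ) 0 :=
      hd.self_of_nhds.continuousAt.sub (by fun_prop)
    simpa [h0] using this.tendsto.mono_left nhdsWithin_le_nhds
  · have : ContinuousAt (fun τ : ℝ => τ^2) 0 := by fun_prop
    simpa using this.tendsto.mono_left nhdsWithin_le_nhds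
  · have h1 := (hasDerivAt_iff_tendsto_slope.1 hd').mono_left
      (nhdsWithin_mono 0 (fun x (hx : 0 < x) => hx.ne'))
    refine (h1.div_const 2).congr fun τ => ?_
    rw [slope_def_field, sub_zero, div_div, mul_comm τ 2]

theorem aux_a3 {V : Type*} [NormedAddCommGroup V] [InnerProductSpace ℝ V] [CompleteSpace V]
    {Ω : Set V} (hΩ : IsOpen Ω) {x₀ : V} (hx₀ : x₀ ∈ Ω) (f0 f1 f2 : V → ℝ) (p0 p1 p2 : V → V)
    (A0 A1 A2 : V →L[ℝ] V)
    (hf0 : ∀ x ∈ Ω, HasFDerivAt f0 (innerSL ℝ (p0 x)) x)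
    (hf1 : ∀ x ∈ Ω, HasFDerivAt f1 (innerSL ℝ (p1 x)) x)
    (hf2 : ∀ x ∈ Ω, HasFDerivAt f2 (innerSL ℝ (p2 x)) x)
    (hp0 : HasFDerivAt p0 A0 x₀) (hp1 : HasFDerivAt p1 A1 x₀) (hp2 : HasFDerivAt p2 A2 x₀)
    (θ : ℝ) (hθ : p2 x₀ = (1 - θ) • p0 x₀ + θ • p1 x₀) (he : p1 x₀ - p0 x₀ ≠ 0)
    (ξ : V) (hξ : ξ ≠ 0) (hort : ⟪p1 x₀ - p0 x₀, ξ⟫ = 0)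
    (η : ℝ → ℝ) (hη : Tendsto η (𝓝[>] (0:ℝ)) (𝓝 0))
    (hmax : ∀ x ∈ Ω, max (f0 x - f0 x₀) (f1 x - f1 x₀) ≥
        f2 x - f2 x₀ - η ‖x - x₀‖ * ‖x - x₀‖ ^ 2) :
    ⟪A2 ξ, ξ⟫ ≤ (1 - θ) * ⟪A0 ξ, ξ⟫ + θ * ⟪A1 ξ, ξ⟫ := by
  set e := p1 x₀ - p0 x₀ with hee
  have hen : 0 < ‖e‖^2 := by positivity
  set k := (⟪A0 ξ, ξ⟫ - ⟪A1 ξ, ξ⟫) / (2 * ‖e‖^2) with hk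
  set γ : ℝ → V := fun τ => x₀ + (τ • ξ + τ^2 • (k • e)) with hγ
  have hγ0 : γ 0 = x₀ := by simp [hγ]
  have hγd : ∀ τ, HasDerivAt γ (ξ + (2 * τ) • (k • e)) τ := by
    intro τ
    have h1 := (hasDerivAt_id τ).smul_const ξ
    have h2 := (hasDerivAt_pow 2 τ).smul_const (k • e)
    have h3 := (h1.add h2).const_add x₀
    simp only [one_smul] at h3
    refine HasDerivAt.congr_deriv (f := γ) h3 ?_
    norm_num
  have hev : ∀ᶠ τ in 𝓝 (0:ℝ), γ τ ∈ Ω :=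
    (hγd 0).continuousAt.eventually (by rw [hγ0]; exact hΩ.mem_nhds hx₀)
  have key : ∀ (f : V → ℝ) (p : V → V) (A : V →L[ℝ] V),
      (∀ x ∈ Ω, HasFDerivAt f (innerSL ℝ (p x)) x) → HasFDerivAt p A x₀ →
      Tendsto (fun τ => ((f (γ τ) - f x₀) - ⟪p x₀, ξ⟫ * τ) / τ^2) (𝓝[>] 0)
        (𝓝 ((⟪A ξ, ξ⟫ + 2 * k * ⟪p x₀, e⟫) / 2)) := by
    intro f p A hf hp
    have := taylor2 (h := fun τ => f (γ τ) - f x₀) (h' := fun τ => ⟪p (γ τ), ξ + (2 * τ) • (k • e)⟫)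
      (H := ⟪A ξ, ξ⟫ + 2 * k * ⟪p x₀, e⟫) (by simp [hγ0]) ?_ ?_
    · simpa [hγ0] using this
    · filter_upwards [hev] with τ hτ
      exact ((hf _ hτ).comp_hasDerivAt τ (hγd τ)).sub_const _
    · have h1 : HasDerivAt (fun τ => p (γ τ)) (A ξ) 0 := by
        have := HasFDerivAt.comp_hasDerivAt (0:ℝ) (l := p) (l' := A) (by rw [hγ0]; exact hp) (hγd 0)
        simpa [Function.comp_def] using this
      have h2 : HasDerivAt (fun τ : ℝ => ξ + (2 * τ) • (k • e)) ((2:ℝ) • (k • e)) 0 := by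
        have := (((hasDerivAt_id (0:ℝ)).const_mul 2).smul_const (k • e)).const_add ξ
        rw [mul_one] at this
        exact this
      have := h1.inner ℝ h2
      refine this.congr_deriv ?_
      simp only [hγ0, mul_zero, zero_smul, add_zero, inner_smul_right]
      ring
  have k0 := key f0 p0 A0 hf0 hp0
  have k1 := key f1 p1 A1 hf1 hp1
  have k2 := key f2 p2 A2 hf2 hp2
  have i1 : ⟪p1 x₀, ξ⟫ = ⟪p0 x₀, ξ⟫ := by
    rw [hee, inner_sub_left] at hort; linarith
  have i2 : ⟪p2 x₀, ξ⟫ = ⟪p0 x₀, ξ⟫ := by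
    rw [hθ, inner_add_left, real_inner_smul_left, real_inner_smul_left, i1]; ring
  have j1 : ⟪p1 x₀, e⟫ = ⟪p0 x₀, e⟫ + ‖e‖^2 := by
    have : p1 x₀ = p0 x₀ + e := by rw [hee]; abel
    rw [this, inner_add_left, real_inner_self_eq_norm_sq]
  have j2 : ⟪p2 x₀, e⟫ = ⟪p0 x₀, e⟫ + θ * ‖e‖^2 := by
    rw [hθ, inner_add_left, real_inner_smul_left, real_inner_smul_left, j1]; ring
  rw [i1, j1] at k1
  rw [i2, j2] at k2
  have hke : 2 * k * ‖e‖^2 = ⟪A0 ξ, ξ⟫ - ⟪A1 ξ, ξ⟫ := by rw [hk]; field_simp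
  -- norm of displacement
  have hn : ∀ τ > 0, ‖γ τ - x₀‖ = τ * ‖ξ + τ • (k • e)‖ := by
    intro τ hτ
    have : γ τ - x₀ = τ • (ξ + τ • (k • e)) := by simp only [hγ]; module
    rw [this, norm_smul, Real.norm_of_nonneg hτ.le]
  have hne : ∀ τ : ℝ, 0 < ‖ξ + τ • (k • e)‖ := by
    intro τ
    rw [norm_pos_iff]
    intro h
    have : ⟪ξ + τ • (k • e), ξ⟫ = 0 := by rw [h, inner_zero_left]
    rw [inner_add_left, real_inner_smul_left, real_inner_smul_left, hort] at this
    simp at this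
    exact hξ this
  have hcn : Tendsto (fun τ : ℝ => ‖ξ + τ • (k • e)‖) (𝓝[>] 0) (𝓝 ‖ξ‖) := by
    have : ContinuousAt (fun τ : ℝ => ‖ξ + τ • (k • e)‖) 0 := by fun_prop
    simpa using this.tendsto.mono_left nhdsWithin_le_nhds
  have hd0 : Tendsto (fun τ => ‖γ τ - x₀‖) (𝓝[>] 0) (𝓝[>] 0) := by
    rw [tendsto_nhdsWithin_iff]
    constructor
    · have : ContinuousAt (fun τ => ‖γ τ - x₀‖) 0 := by fun_prop
      simpa [hγ0] using this.tendsto.mono_left nhdsWithin_le_nhds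
    · filter_upwards [self_mem_nhdsWithin] with τ hτ
      have hτ : 0 < τ := hτ
      change 0 < ‖γ τ - x₀‖
      rw [hn τ hτ]; exact mul_pos hτ (hne τ)
  have hη' : Tendsto (fun τ => η ‖γ τ - x₀‖ * ‖ξ + τ • (k • e)‖^2) (𝓝[>] 0) (𝓝 0) := by
    simpa using (hη.comp hd0).mul (hcn.pow 2)
  have hle := le_of_tendsto_of_tendsto (k2.sub hη') (k0.max k1) (by
    filter_upwards [hev.filter_mono nhdsWithin_le_nhds, self_mem_nhdsWithin] with τ h1 h2
    have h2 : 0 < τ := h2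
    have h3 := hmax _ h1
    rw [hn τ h2] at h3 ⊢
    have hτ2 : 0 < τ^2 := by positivity
    rw [max_div_div_right hτ2.le, max_sub_sub_right, le_div_iff₀ hτ2, sub_mul,
      div_mul_cancel₀ _ hτ2.ne']
    rw [mul_pow] at h3
    linarith)
  have hmx : max ((⟪A0 ξ, ξ⟫ + 2 * k * ⟪p0 x₀, e⟫) / 2)
      ((⟪A1 ξ, ξ⟫ + 2 * k * (⟪p0 x₀, e⟫ + ‖e‖ ^ 2)) / 2) = (⟪A0 ξ, ξ⟫ + 2 * k * ⟪p0 x₀, e⟫) / 2 := by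
    rw [mul_add, hke]
    apply max_eq_left
    linarith
  rw [hmx] at hle
  have : 2 * k * (θ * ‖e‖^2) = θ * (⟪A0 ξ, ξ⟫ - ⟪A1 ξ, ξ⟫) := by rw [← hke]; ring
  rw [mul_add, this] at hle
  linarith

section build
variable {V : Type*} [NormedAddCommGroup V] [InnerProductSpace ℝ V] [FiniteDimensional ℝ V]

/-- Riesz representative of the restriction of a functional along a linear map. -/
def RR (i : V →L[ℝ] V × V) : (V × V →L[ℝ] ℝ) →L[ℝ] V :=
  LinearMap.toContinuousLinearMap
    { toFun := fun φ => (InnerProductSpace.toDual ℝ V).symm (φ.comp i)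
      map_add' := fun φ ψ => by
        refine ext_inner_right ℝ fun v => ?_
        simp [inner_add_left]
      map_smul' := fun a φ => by
        refine ext_inner_right ℝ fun v => ?_
        simp [inner_smul_left] }

theorem RR_apply (i : V →L[ℝ] V × V) (φ : V × V →L[ℝ] ℝ) :
    RR i φ = (InnerProductSpace.toDual ℝ V).symm (φ.comp i) := rfl

theorem RR_inner (i : V →L[ℝ] V × V) (φ : V × V →L[ℝ] ℝ) (v : V) :
    ⟪RR i φ, v⟫ = φ (i v) := by
  rw [RR_apply]; simp
end build

section build2
variable {n : ℕ} {c : E n → E n → ℝ} {U : Set (E n × E n)}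

/-- joint derivative -/
def FF (c : E n → E n → ℝ) (p : E n × E n) : E n × E n →L[ℝ] ℝ := fderiv ℝ (fun p => c p.1 p.2) p
/-- joint second derivative -/
def GG (c : E n → E n → ℝ) (p : E n × E n) : E n × E n →L[ℝ] (E n × E n →L[ℝ] ℝ) :=
  fderiv ℝ (FF c) p

theorem FF_has (hU : IsOpen U) (hc : ContDiffOn ℝ 2 (fun p : E n × E n => c p.1 p.2) U)
    {p : E n × E n} (hp : p ∈ U) : HasFDerivAt (fun p : E n × E n => c p.1 p.2) (FF c p) p :=
  ((hc.contDiffAt (hU.mem_nhds hp)).differentiableAt (by norm_num)).hasFDerivAt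

theorem FF_contDiff (hU : IsOpen U) (hc : ContDiffOn ℝ 2 (fun p : E n × E n => c p.1 p.2) U) :
    ContDiffOn ℝ 1 (FF c) U := hc.fderiv_of_isOpen hU (by norm_num)

theorem GG_has (hU : IsOpen U) (hc : ContDiffOn ℝ 2 (fun p : E n × E n => c p.1 p.2) U)
    {p : E n × E n} (hp : p ∈ U) : HasFDerivAt (FF c) (GG c p) p :=
  (((FF_contDiff hU hc).contDiffAt (hU.mem_nhds hp)).differentiableAt (by norm_num)).hasFDerivAt

theorem GG_cont (hU : IsOpen U) (hc : ContDiffOn ℝ 2 (fun p : E n × E n => c p.1 p.2) U) :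
    ContinuousOn (GG c) U := (FF_contDiff hU hc).continuousOn_fderiv_of_isOpen hU (by norm_num)

theorem GG_symm (hU : IsOpen U) (hc : ContDiffOn ℝ 2 (fun p : E n × E n => c p.1 p.2) U)
    {p : E n × E n} (hp : p ∈ U) (a b : E n × E n) : GG c p a b = GG c p b a :=
  (hc.contDiffAt (hU.mem_nhds hp)).isSymmSndFDerivAt (by simp) a b

theorem cx_has (hU : IsOpen U) (hc : ContDiffOn ℝ 2 (fun p : E n × E n => c p.1 p.2) U)
    {x y : E n} (hp : (x, y) ∈ U) :
    HasFDerivAt (fun x' => c x' y) ((FF c (x, y)).comp (.inl ℝ _ _)) x :=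
  (FF_has hU hc hp).comp (f := fun x' => (x', y)) x (hasFDerivAt_prodMk_left x y)

theorem cy_has (hU : IsOpen U) (hc : ContDiffOn ℝ 2 (fun p : E n × E n => c p.1 p.2) U)
    {x y : E n} (hp : (x, y) ∈ U) :
    HasFDerivAt (fun y' => c x y') ((FF c (x, y)).comp (.inr ℝ _ _)) y :=
  (FF_has hU hc hp).comp (f := fun y' => (x, y')) y (hasFDerivAt_prodMk_right x y)

theorem Dx_eq (hU : IsOpen U) (hc : ContDiffOn ℝ 2 (fun p : E n × E n => c p.1 p.2) U)
    {x y : E n} (hp : (x, y) ∈ U) : Dx c x y = RR (.inl ℝ _ _) (FF c (x, y)) := by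
  rw [Dx, gradient, (cx_has hU hc hp).fderiv, RR_apply]

theorem Dy_eq (hU : IsOpen U) (hc : ContDiffOn ℝ 2 (fun p : E n × E n => c p.1 p.2) U)
    {x y : E n} (hp : (x, y) ∈ U) : Dy c x y = RR (.inr ℝ _ _) (FF c (x, y)) := by
  rw [Dy, gradient, (cy_has hU hc hp).fderiv, RR_apply]

theorem Dx_has (hU : IsOpen U) (hc : ContDiffOn ℝ 2 (fun p : E n × E n => c p.1 p.2) U)
    {x y : E n} (hp : (x, y) ∈ U) : HasFDerivAt (fun p : E n × E n => Dx c p.1 p.2)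
      ((RR (.inl ℝ _ _)).comp (GG c (x, y))) (x, y) := by
  have h := (RR (V := E n) (.inl ℝ _ _)).hasFDerivAt.comp (x, y) (GG_has hU hc hp)
  refine h.congr_of_eventuallyEq ?_
  filter_upwards [hU.mem_nhds hp] with p hp using Dx_eq hU hc hp

theorem Dy_has (hU : IsOpen U) (hc : ContDiffOn ℝ 2 (fun p : E n × E n => c p.1 p.2) U)
    {x y : E n} (hp : (x, y) ∈ U) : HasFDerivAt (fun p : E n × E n => Dy c p.1 p.2)
      ((RR (.inr ℝ _ _)).comp (GG c (x, y))) (x, y) := by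
  have h := (RR (V := E n) (.inr ℝ _ _)).hasFDerivAt.comp (x, y) (GG_has hU hc hp)
  refine h.congr_of_eventuallyEq ?_
  filter_upwards [hU.mem_nhds hp] with p hp using Dy_eq hU hc hp

/-- x-derivative of P -/
def PPx (c : E n → E n → ℝ) (x y : E n) : E n →L[ℝ] E n :=
  (-((RR (.inl ℝ _ _)).comp (GG c (x, y)))).comp (.inl ℝ _ _)
/-- y-derivative of P -/
def PPy (c : E n → E n → ℝ) (x y : E n) : E n →L[ℝ] E n :=
  (-((RR (.inl ℝ _ _)).comp (GG c (x, y)))).comp (.inr ℝ _ _)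
/-- x-derivative of q -/
def QQx (c : E n → E n → ℝ) (x y : E n) : E n →L[ℝ] E n :=
  (-((RR (.inr ℝ _ _)).comp (GG c (x, y)))).comp (.inl ℝ _ _)

theorem f_has (hU : IsOpen U) (hc : ContDiffOn ℝ 2 (fun p : E n × E n => c p.1 p.2) U)
    {x y : E n} (hp : (x, y) ∈ U) :
    HasFDerivAt (fun x' => -c x' y) (innerSL ℝ (-Dx c x y)) x := by
  refine (cx_has hU hc hp).neg.congr_fderiv ?_
  refine ContinuousLinearMap.ext fun v => ?_
  rw [innerSL_apply_apply, inner_neg_left, Dx_eq hU hc hp, RR_inner]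
  simp

theorem mkPData (Ω Ωs : Set (E n)) (oΩ : IsOpen Ω) (oΩs : IsOpen Ωs)
    (hU : IsOpen U) (hc : ContDiffOn ℝ 2 (fun p : E n × E n => c p.1 p.2) U) (hsub : Ω ×ˢ Ωs ⊆ U)
    (h1 : CondA1 Ω Ωs c) (h2 : CondA2 Ω Ωs c)
    (hmc : MutuallyCConvex Ω Ωs c) (h3 : CondA3v Ω Ωs c) :
    PData Ω Ωs (fun x y => -Dx c x y) (PPx c) (PPy c) := by
  have hGc := (GG_cont hU hc).mono hsub
  have hP : ∀ x ∈ Ω, ∀ y ∈ Ωs,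
    HasFDerivAt (fun p : E n × E n => -Dx c p.1 p.2) ((PPx c x y).coprod (PPy c x y)) (x, y) := by
    intro x hx y hy
    refine (Dx_has hU hc (hsub ⟨hx, hy⟩)).neg.congr_fderiv ?_
    refine ContinuousLinearMap.ext fun v => ?_
    have : v = (v.1, 0) + (0, v.2) := by simp
    conv_lhs => rw [this, map_add]
    simp [PPx, PPy]
  have hPx : ∀ x ∈ Ω, ∀ y ∈ Ωs, HasFDerivAt (fun x => -Dx c x y) (PPx c x y) x := by
    intro x hx y hy
    have h := (hP x hx y hy).comp (f := fun x => (x, y)) x (hasFDerivAt_prodMk_left x y)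
    refine h.congr_fderiv ?_
    refine ContinuousLinearMap.ext fun v => ?_
    simp
  refine ⟨oΩ, oΩs, hP, ?_, ?_, ?_, h1.1, hmc.1, ?_⟩
  · exact (continuousOn_const.clm_comp hGc).neg.clm_comp continuousOn_const
  · exact (continuousOn_const.clm_comp hGc).neg.clm_comp continuousOn_const
  · intro x hx y hy
    have hb := h2 x hx y hy
    have h := (Dx_has hU hc (hsub ⟨hx, hy⟩)).comp (f := fun y => (x, y)) y (hasFDerivAt_prodMk_right x y)
    have e : Dxy c x y = ((RR (.inl ℝ _ _)).comp (GG c (x, y))).comp (.inr ℝ _ _) := h.fderiv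
    have e2 : ⇑(PPy c x y) = Neg.neg ∘ ⇑(Dxy c x y) := by
      rw [e]; funext v; simp [PPy]
    rw [e2]
    exact neg_bijective.comp hb
  · intro x hx y₀ hy₀ y₁ hy₁ yθ hyθ θ hθ hPθ ξ hξ
    by_cases he : -Dx c x y₁ - -Dx c x y₀ = 0
    · have e1 : y₁ = y₀ := h1.1 x hx hy₁ hy₀ (sub_eq_zero.1 he)
      have e2 : yθ = y₀ := by
        refine h1.1 x hx hyθ hy₀ ?_
        simp only
        rw [hPθ, e1]; module
      rw [e1, e2]; linarith
    by_cases hξ0 : ξ = 0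
    · simp [hξ0]
    obtain ⟨η, hη, hmax⟩ := h3 x hx y₀ hy₀ y₁ hy₁ θ hθ yθ hyθ hPθ
    refine aux_a3 oΩ hx (fun x => -c x y₀) (fun x => -c x y₁) (fun x => -c x yθ)
      (fun x => -Dx c x y₀) (fun x => -Dx c x y₁) (fun x => -Dx c x yθ) _ _ _
      (fun x hx => f_has hU hc (hsub ⟨hx, hy₀⟩)) (fun x hx => f_has hU hc (hsub ⟨hx, hy₁⟩))
      (fun x hx => f_has hU hc (hsub ⟨hx, hyθ⟩)) (hPx x hx y₀ hy₀) (hPx x hx y₁ hy₁)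
      (hPx x hx yθ hyθ) θ hPθ he ξ hξ0 hξ η hη ?_
    intro x' hx'
    have := hmax x' hx'
    have a : ∀ y, -c x' y - -c x y = c x y - c x' y := fun y => by ring
    simp only [a]
    exact this
end build2

/-- under A1, A2, mutual c-convexity and A3v, the sub-level set
`{x ∈ Ω : c(x,y₀) − c(x,y₁) ≤ σ}` is c-convex with respect to `y₀`. -/
theorem sublevel_set_cConvex {n : ℕ} (hn : 1 ≤ n)
    (Ω Ωs : Set (E n)) (c : E n → E n → ℝ)
    (hΩ : NiceDomain Ω) (hΩs : NiceDomain Ωs)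
    (hc : CostC2 Ω Ωs c) (h1 : CondA1 Ω Ωs c) (h2 : CondA2 Ω Ωs c)
    (hmc : MutuallyCConvex Ω Ωs c) (h3 : CondA3v Ω Ωs c) :
    ∀ y₀ ∈ Ωs, ∀ y₁ ∈ Ωs, ∀ σ : ℝ,
      Convex ℝ ((fun x => -Dy c x y₀) '' {x ∈ Ω | c x y₀ - c x y₁ ≤ σ}) := by
  intro y₀ hy₀ y₁ hy₁ σ
  obtain ⟨U, hU, hsub, hcU⟩ := hc
  have D := mkPData Ω Ωs hΩ.2.1 hΩs.2.1 hU hcU hsub h1 h2 hmc h3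
  refine D.final hy₀ hy₁ (fun x => -Dy c x y₀) (fun x => QQx c x y₀) ?_ ?_ ?_ (h1.2 y₀ hy₀)
    (hmc.2 y₀ hy₀) (fun x => c x y₀ - c x y₁) ?_ σ
  · intro x hx
    exact (Dy_has hU hcU (hsub ⟨hx, hy₀⟩)).neg.comp (f := fun x => (x, y₀)) x
      (hasFDerivAt_prodMk_left x y₀)
  · intro x hx ξ v
    have hp : (x, y₀) ∈ U := hsub ⟨hx, hy₀⟩
    have e1 : QQx c x y₀ ξ = -(RR (.inr ℝ _ _) (GG c (x, y₀) (ξ, 0))) := by simp [QQx]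
    have e2 : PPy c x y₀ v = -(RR (.inl ℝ _ _) (GG c (x, y₀) (0, v))) := by simp [PPy]
    rw [e1, e2, inner_neg_left, inner_neg_left, RR_inner, RR_inner]
    simp only [ContinuousLinearMap.inr_apply, ContinuousLinearMap.inl_apply]
    rw [GG_symm hU hcU hp]
  · have hGc : ContinuousOn (fun x => GG c (x, y₀)) Ω :=
      (GG_cont hU hcU).comp (by fun_prop) fun x hx => hsub ⟨hx, hy₀⟩
    exact (continuousOn_const.clm_comp hGc).neg.clm_comp continuousOn_const
  · intro x hx
    have a0 := f_has hU hcU (hsub ⟨hx, hy₀⟩)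
    have a1 := f_has hU hcU (hsub ⟨hx, hy₁⟩)
    have := a1.sub a0
    rw [← map_sub] at this
    refine this.congr_of_eventuallyEq (Eventually.of_forall fun z => ?_)
    simp only [Pi.sub_apply]
    ring
end
end

section
/- Assume the C² cost function c satisfies conditions A1 and A2. Fix x₀ ∈ Ω and y₀, y₁ ∈ Ω*, set p_i = −D_x c(x₀,y_i), and let θ ↦ y_θ be the c-segment from y₀ to y₁ with respect to x₀ (a continuous curve in Ω* with −D_x c(x₀,y_θ) = (1−θ)p₀ + θp₁). For x ∈ Ω define h_θ(x) = c(x,y₀) − c(x,y_θ) − c(x₀,y₀) + c(x₀,y_θ). Then for every x ∈ Ω the function θ ↦ h_θ(x) is right-differentiable at θ = 0 and lim_{θ→0⁺} h_θ(x)/θ = ⟨D_y c(x,y₀) − D_y c(x₀,y₀), (D²_{xy}c(x₀,y₀))⁻¹(p₁ − p₀)⟩. In particular, the boundaries of the sections S_θ = {x ∈ Ω : h_θ(x) ≤ 0} converge as θ → 0⁺ to the c*-hyperplane H₀ = {x ∈ Ω : ⟨D_y c(x,y₀) − D_y c(x₀,y₀), (D²_{xy}c(x₀,y₀))⁻¹(p₁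 − p₀)⟩ = 0}, in the sense that the zero set of the limit function lim_{θ→0⁺} h_θ/θ is exactly H₀. -/
open Set Filter Topology MeasureTheory RealInnerProductSpace

noncomputable section

theorem Dx_contDiffAt {n : ℕ} (c : E n → E n → ℝ) (x y : E n)
    (h : ContDiffAt ℝ 2 (fun p : E n × E n => c p.1 p.2) (x, y)) :
    ContDiffAt ℝ 1 (fun y' => Dx c x y') y := by
  have hs : ContDiffAt ℝ 2 (Function.uncurry (fun y' x' : E n => c x' y')) (y, x) := by
    have : ContDiffAt ℝ 2 (fun q : E n × E n => (q.2, q.1)) (y, x) := by fun_prop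
    exact ContDiffAt.comp (y, x) (f := fun q : E n × E n => (q.2, q.1)) h this
  have hf := ContDiffAt.fderiv (m := 1) (g := fun _ : E n => x) hs contDiffAt_const
    (by norm_num)
  exact ((InnerProductSpace.toDual ℝ (E n)).symm.toContinuousLinearEquiv.contDiff.contDiffAt).comp
    y hf

theorem hasFDerivAt_Dy {n : ℕ} (c : E n → E n → ℝ) (x y : E n)
    (h : ContDiffAt ℝ 2 (fun p : E n × E n => c p.1 p.2) (x, y)) :
    HasFDerivAt (fun y' => c x y') (InnerProductSpace.toDual ℝ (E n) (Dy c x y)) y := by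
  have hd : DifferentiableAt ℝ (fun y' => c x y') y := by
    have h1 := h.differentiableAt (by norm_num)
    exact DifferentiableAt.comp y (f := fun y' : E n => (x, y')) h1 (by fun_prop)
  exact hd.hasGradientAt.hasFDerivAt

/-- under A1 and A2, with `h_θ(x) = c(x,y₀) − c(x,y_θ) − c(x₀,y₀) + c(x₀,y_θ)`,
for every `x ∈ Ω` the quotient `h_θ(x)/θ` converges as `θ → 0⁺` to
`⟨D_y c(x,y₀) − D_y c(x₀,y₀), (D²_{xy}c(x₀,y₀))⁻¹(p₁ − p₀)⟩`; in particular the zero set of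
this limit function is exactly the c*-hyperplane `H₀`. -/
theorem sections_converge_to_cHyperplane {n : ℕ} (hn : 1 ≤ n)
    (Ω Ωs : Set (E n)) (c : E n → E n → ℝ)
    (hΩ : NiceDomain Ω) (hΩs : NiceDomain Ωs)
    (hc : CostC2 Ω Ωs c) (h1 : CondA1 Ω Ωs c) (h2 : CondA2 Ω Ωs c)
    (x₀ : E n) (hx₀ : x₀ ∈ Ω) (y₀ y₁ : E n) (hy₀ : y₀ ∈ Ωs) (hy₁ : y₁ ∈ Ωs)
    (y : ℝ → E n) (hycont : ContinuousOn y (Icc 0 1)) (hy0 : y 0 = y₀)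
    (hymem : ∀ θ ∈ Icc (0:ℝ) 1, y θ ∈ Ωs)
    (hyseg : ∀ θ ∈ Icc (0:ℝ) 1,
      -Dx c x₀ (y θ) = (1 - θ) • (-Dx c x₀ y₀) + θ • (-Dx c x₀ y₁)) :
    (∀ x ∈ Ω,
      Tendsto (fun θ => (c x y₀ - c x (y θ) - c x₀ y₀ + c x₀ (y θ)) / θ) (𝓝[>] (0:ℝ))
        (𝓝 ⟪Dy c x y₀ - Dy c x₀ y₀,
             Ring.inverse (Dxy c x₀ y₀) ((-Dx c x₀ y₁) - (-Dx c x₀ y₀))⟫)) ∧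
    ∀ L : E n → ℝ,
      (∀ x ∈ Ω,
        Tendsto (fun θ => (c x y₀ - c x (y θ) - c x₀ y₀ + c x₀ (y θ)) / θ) (𝓝[>] (0:ℝ))
          (𝓝 (L x))) →
      {x ∈ Ω | L x = 0} =
        {x ∈ Ω | ⟪Dy c x y₀ - Dy c x₀ y₀,
                  Ring.inverse (Dxy c x₀ y₀) ((-Dx c x₀ y₁) - (-Dx c x₀ y₀))⟫ = 0} := by
  obtain ⟨U, hU, hsub, hcU⟩ := hc
  have hcd : ∀ x ∈ Ω, ContDiffAt ℝ 2 (fun p : E n × E n => c p.1 p.2) (x, y₀) := fun x hx =>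
    hcU.contDiffAt (hU.mem_nhds (hsub ⟨hx, hy₀⟩))
  set v : E n := (-Dx c x₀ y₁) - (-Dx c x₀ y₀) with hv
  have hbij := h2 x₀ hx₀ y₀ hy₀
  let A : E n ≃L[ℝ] E n :=
    (LinearEquiv.ofBijective (Dxy c x₀ y₀).toLinearMap hbij).toContinuousLinearEquiv
  have hA : (A : E n →L[ℝ] E n) = Dxy c x₀ y₀ := by ext1 w; rfl
  have hinv : Ring.inverse (Dxy c x₀ y₀) = (A.symm : E n →L[ℝ] E n) := by
    rw [← hA, ContinuousLinearMap.ringInverse_equiv, ContinuousLinearMap.inverse_equiv]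
  have hF : HasStrictFDerivAt (fun y' => Dx c x₀ y') (A : E n →L[ℝ] E n) y₀ := by
    rw [hA]
    exact (Dx_contDiffAt c x₀ y₀ (hcd x₀ hx₀)).hasStrictFDerivAt (by norm_num)
  have hyt : Tendsto y (𝓝[>] 0) (𝓝 y₀) := by
    have := (hycont 0 (by simp)).mono_left (nhdsWithin_le_of_mem (Icc_mem_nhdsGT one_pos))
    rwa [hy0] at this
  have hyd : HasDerivWithinAt y (-(A.symm v)) (Ioi 0) 0 := by
    have hl := hF.to_localInverse.hasFDerivAt
    have hcurve : HasDerivAt (fun θ : ℝ => Dx c x₀ y₀ - θ • v) (-v) 0 := by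
      simpa using ((hasDerivAt_id (0:ℝ)).smul_const v).const_sub (Dx c x₀ y₀)
    have hl' : HasFDerivAt (hF.localInverse (fun y' => Dx c x₀ y') A y₀)
        (A.symm : E n →L[ℝ] E n) (Dx c x₀ y₀ - (0:ℝ) • v) := by simpa using hl
    have hcomp := hl'.comp_hasDerivAt (0:ℝ) hcurve
    have hcomp' := hcomp.hasDerivWithinAt (s := Ioi 0)
    have e : ∀ᶠ θ in 𝓝[>] (0:ℝ), y θ =
        hF.localInverse (fun y' => Dx c x₀ y') A y₀ (Dx c x₀ y₀ - θ • v) := by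
      filter_upwards [hyt.eventually hF.eventually_left_inverse, Icc_mem_nhdsGT one_pos]
        with θ h3 h4
      have h5 := hyseg θ h4
      have h6 : Dx c x₀ (y θ) = Dx c x₀ y₀ - θ • v := by
        rw [← neg_neg (Dx c x₀ (y θ)), h5, hv]
        module
      rw [← h6]; exact h3.symm
    have h0 : y 0 = hF.localInverse (fun y' => Dx c x₀ y') A y₀ (Dx c x₀ y₀ - (0:ℝ) • v) := by
      rw [hy0, zero_smul, sub_zero]
      exact hF.localInverse_apply_image.symm
    simpa using hcomp'.congr_of_eventuallyEq e h0
  have main : ∀ x ∈ Ω,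
      Tendsto (fun θ => (c x y₀ - c x (y θ) - c x₀ y₀ + c x₀ (y θ)) / θ) (𝓝[>] (0:ℝ))
        (𝓝 ⟪Dy c x y₀ - Dy c x₀ y₀, Ring.inverse (Dxy c x₀ y₀) v⟫) := by
    intro x hx
    have hd : ∀ z ∈ Ω, HasDerivWithinAt (fun θ => c z (y θ)) (-⟪Dy c z y₀, A.symm v⟫)
        (Ioi 0) 0 := by
      intro z hz
      have h3 := hasFDerivAt_Dy c z y₀ (hcd z hz)
      rw [← hy0] at h3
      have := h3.comp_hasDerivWithinAt (0:ℝ) hyd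
      simpa [hy0, Function.comp_def] using this
    have h4 := hasDerivWithinAt_iff_tendsto_slope.1 ((hd x₀ hx₀).sub (hd x hx))
    rw [diff_singleton_eq_self (by simp)] at h4
    have e1 : ⟪Dy c x y₀ - Dy c x₀ y₀, Ring.inverse (Dxy c x₀ y₀) v⟫ =
        -⟪Dy c x₀ y₀, A.symm v⟫ - -⟪Dy c x y₀, A.symm v⟫ := by
      rw [hinv, inner_sub_left]; simp only [ContinuousLinearEquiv.coe_coe]; ring
    rw [e1]
    refine h4.congr fun θ => ?_
    simp only [slope_def_field, hy0, Pi.sub_apply]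
    ring
  refine ⟨main, fun L hL => ?_⟩
  ext x
  simp only [mem_ofPred_eq]
  refine and_congr_right fun hx => ?_
  rw [tendsto_nhds_unique (hL x hx) (main x hx)]
end
end

section
/- Suppose the C² cost function c satisfies conditions A1, A2, Ω and Ω* are c-convex with respect to each other, and c satisfies condition A3v. Fix x₀ ∈ Ω and y₀, y₁ ∈ Ω*, set p_i = −D_x c(x₀,y_i), and let θ ↦ y_θ be the c-segment from y₀ to y₁ with respect to x₀. Then for every ξ ∈ ℝⁿ with ⟨ξ, p₁ − p₀⟩ = 0, the function θ ↦ −D²_{xx}c(x₀, y_θ)(ξ, ξ) is convex on [0,1]; equivalently, for all θ ∈ [0,1], −D²_{xx}c(x₀,y_θ)(ξ,ξ) ≤ (1−θ)(−D²_{xx}c(x₀,y₀)(ξ,ξ)) + θ(−D²_{xx}c(x₀,y₁)(ξ,ξ)). -/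
open Set Filter Topology MeasureTheory RealInnerProductSpace

noncomputable section

theorem aux_peano (φ φ' : ℝ → ℝ) (L : ℝ) (h : ∀ᶠ t in 𝓝 (0:ℝ), HasDerivAt φ (φ' t) t)
    (h' : HasDerivAt φ' L 0) :
    Tendsto (fun t => (φ t - φ 0 - t * φ' 0) / t ^ 2) (𝓝[>] 0) (𝓝 (L / 2)) := by
  have h0 : HasDerivAt φ (φ' 0) 0 := h.self_of_nhds
  refine HasDerivAt.lhopital_zero_nhdsGT (f' := fun t => φ' t - φ' 0) (g' := fun t => 2 * t)
    ?_ ?_ ?_ ?_ ?_ ?_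
  · filter_upwards [nhdsWithin_le_nhds h] with t ht
    have := (ht.sub_const (φ 0)).fun_sub ((hasDerivAt_id t).mul_const (φ' 0))
    simpa using this
  · refine Eventually.of_forall fun t => ?_
    simpa using hasDerivAt_pow 2 t
  · filter_upwards [self_mem_nhdsWithin] with t ht
    have : (0:ℝ) < t := ht
    positivity
  · have hc : ContinuousAt (fun t => φ t - φ 0 - t * φ' 0) 0 := by
      have := h0.continuousAt
      fun_prop
    have := hc.tendsto.mono_left (nhdsWithin_le_nhds (s := Ioi 0))
    simpa using this
  · have hc : ContinuousAt (fun t : ℝ => t ^ 2) 0 := by fun_prop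
    have := hc.tendsto.mono_left (nhdsWithin_le_nhds (s := Ioi 0))
    simpa using this
  · have h1 := h'.tendsto_slope.mono_left (nhdsWithin_mono (0:ℝ) (s := Ioi 0) (t := {0}ᶜ)
      (fun t ht => ne_of_gt ht))
    have h2 := h1.div_const 2
    refine h2.congr' ?_
    filter_upwards [self_mem_nhdsWithin] with t ht
    have : t ≠ 0 := ne_of_gt ht
    simp only [slope_def_field, sub_zero]
    field_simp

theorem aux_expand {n : ℕ} (Ω Ωs : Set (E n)) (c : E n → E n → ℝ)
    (hc : CostC2 Ω Ωs c) (x₀ : E n) (hx₀ : x₀ ∈ Ω) (y : E n) (hy : y ∈ Ωs) (ξ w : E n) :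
    Tendsto (fun t : ℝ => (c x₀ y - c (x₀ + (t • ξ + t ^ 2 • w)) y - t * ⟪-Dx c x₀ y, ξ⟫) / t ^ 2)
      (𝓝[>] 0) (𝓝 (-DxxQ c x₀ y ξ / 2 + ⟪-Dx c x₀ y, w⟫)) := by
  obtain ⟨U, hU, hsub, hcd⟩ := hc
  have hmem : (x₀, y) ∈ U := hsub ⟨hx₀, hy⟩
  have hCat : ContDiffAt ℝ 2 (fun p : E n × E n => c p.1 p.2) (x₀, y) :=
    hcd.contDiffAt (hU.mem_nhds hmem)
  have hg : ContDiffAt ℝ 2 (fun x' => c x' y) x₀ :=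
    hCat.comp x₀ (f := fun x' : E n => (x', y)) (by fun_prop)
  have hd : ∀ᶠ x in 𝓝 x₀, DifferentiableAt ℝ (fun x' => c x' y) x := by
    filter_upwards [hg.eventually (by simp)] with x hx
    exact hx.differentiableAt (by simp)
  have hD : DifferentiableAt ℝ (fun x' => Dx c x' y) x₀ := by
    have h1 : DifferentiableAt ℝ (fderiv ℝ (fun x' => c x' y)) x₀ :=
      (hg.fderiv_right (m := 1) (by norm_num)).differentiableAt (by simp)
    have : (fun x' => Dx c x' y) = fun x' => (InnerProductSpace.toDual ℝ (E n)).symm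
      (fderiv ℝ (fun x' => c x' y) x') := rfl
    rw [this]
    exact (InnerProductSpace.toDual ℝ (E n)).symm.toContinuousLinearEquiv.differentiableAt.comp
      x₀ h1
  have hγ : ∀ t : ℝ, HasDerivAt (fun t : ℝ => x₀ + (t • ξ + t ^ 2 • w)) (ξ + (2 * t) • w) t := by
    intro t
    have h1 := ((hasDerivAt_id t).smul_const ξ).add ((hasDerivAt_pow 2 t).smul_const w)
    have := h1.const_add x₀
    simpa using this
  have hγ0 : Tendsto (fun t : ℝ => x₀ + (t • ξ + t ^ 2 • w)) (𝓝 0) (𝓝 x₀) := by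
    have := (hγ 0).continuousAt.tendsto
    simpa using this
  have key := aux_peano (fun t => -c (x₀ + (t • ξ + t ^ 2 • w)) y)
    (fun t => -⟪Dx c (x₀ + (t • ξ + t ^ 2 • w)) y, ξ + (2 * t) • w⟫)
    (-(DxxQ c x₀ y ξ + 2 * ⟪Dx c x₀ y, w⟫)) ?_ ?_
  · convert key using 2
    · simp
      ring
    · simp [inner_neg_left]
      ring
  · filter_upwards [hγ0.eventually hd] with t ht
    have h1 := ht.hasGradientAt.hasFDerivAt.comp_hasDerivAt t (hγ t)
    rw [InnerProductSpace.toDual_apply_apply] at h1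
    exact h1.neg
  · have h1 : HasDerivAt (fun t : ℝ => Dx c (x₀ + (t • ξ + t ^ 2 • w)) y)
        (fderiv ℝ (fun x' => Dx c x' y) x₀ ξ) 0 := by
      have e : x₀ + ((0:ℝ) • ξ + (0:ℝ) ^ 2 • w) = x₀ := by simp
      have h2 : HasFDerivAt (fun x' => Dx c x' y) (fderiv ℝ (fun x' => Dx c x' y) x₀)
        (x₀ + ((0:ℝ) • ξ + (0:ℝ) ^ 2 • w)) := by rw [e]; exact hD.hasFDerivAt
      have : HasDerivAt (fun t : ℝ => Dx c (x₀ + (t • ξ + t ^ 2 • w)) y) _ 0 :=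
        h2.comp_hasDerivAt (0:ℝ) (hγ 0)
      simpa using this
    have h3 : HasDerivAt (fun t : ℝ => ξ + (2 * t) • w) ((2:ℝ) • w) 0 := by
      have := (((hasDerivAt_id (0:ℝ)).const_mul 2).smul_const w).const_add ξ
      simpa using this
    have := (h1.inner ℝ h3).fun_neg
    refine this.congr_deriv ?_
    simp [DxxQ, inner_smul_right]
    ring

theorem aux_chord {n : ℕ} (Ω Ωs : Set (E n)) (c : E n → E n → ℝ)
    (hΩ : NiceDomain Ω)
    (hc : CostC2 Ω Ωs c) (h1 : CondA1 Ω Ωs c) (h3 : CondA3v Ω Ωs c)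
    (x₀ : E n) (hx₀ : x₀ ∈ Ω) (y₀ y₁ : E n) (hy₀ : y₀ ∈ Ωs) (hy₁ : y₁ ∈ Ωs)
    (θ : ℝ) (hθ : θ ∈ Ioo (0:ℝ) 1) (z : E n) (hz : z ∈ Ωs)
    (hseg : -Dx c x₀ z = (1 - θ) • (-Dx c x₀ y₀) + θ • (-Dx c x₀ y₁))
    (ξ : E n) (hξ : ⟪ξ, (-Dx c x₀ y₁) - (-Dx c x₀ y₀)⟫ = 0) :
    -DxxQ c x₀ z ξ ≤ (1 - θ) * (-DxxQ c x₀ y₀ ξ) + θ * (-DxxQ c x₀ y₁ ξ) := by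
  by_cases hξ0 : ξ = 0
  · simp [hξ0, DxxQ]
  by_cases hv : (-Dx c x₀ y₁) - (-Dx c x₀ y₀) = 0
  · have e1 : -Dx c x₀ y₁ = -Dx c x₀ y₀ := sub_eq_zero.mp hv
    have e2 : y₁ = y₀ := h1.1 x₀ hx₀ hy₁ hy₀ e1
    have e3 : -Dx c x₀ z = -Dx c x₀ y₀ := by
      rw [hseg, e1, ← add_smul]; simp
    have e4 : z = y₀ := h1.1 x₀ hx₀ hz hy₀ e3
    rw [e2, e4]
    linarith
  obtain ⟨η, hη, hA⟩ := h3 x₀ hx₀ y₀ hy₀ y₁ hy₁ θ hθ z hz hseg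
  obtain ⟨w, hw⟩ : ∃ w : E n, ⟪(-Dx c x₀ y₁) - (-Dx c x₀ y₀), w⟫ =
      (-DxxQ c x₀ y₀ ξ - -DxxQ c x₀ y₁ ξ) / 2 := by
    set v := (-Dx c x₀ y₁) - (-Dx c x₀ y₀)
    refine ⟨((-DxxQ c x₀ y₀ ξ - -DxxQ c x₀ y₁ ξ) / 2 / ‖v‖ ^ 2) • v, ?_⟩
    have : ‖v‖ ≠ 0 := norm_ne_zero_iff.mpr hv
    rw [inner_smul_right, real_inner_self_eq_norm_sq]
    field_simp
  have T0 := aux_expand Ω Ωs c hc x₀ hx₀ y₀ hy₀ ξ w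
  have T1 := aux_expand Ω Ωs c hc x₀ hx₀ y₁ hy₁ ξ w
  have Tz := aux_expand Ω Ωs c hc x₀ hx₀ z hz ξ w
  have a1 : ⟪-Dx c x₀ y₁, ξ⟫ = ⟪-Dx c x₀ y₀, ξ⟫ := by
    rw [real_inner_comm, inner_sub_left] at hξ
    linarith
  have az : ⟪-Dx c x₀ z, ξ⟫ = ⟪-Dx c x₀ y₀, ξ⟫ := by
    rw [hseg, inner_add_left, real_inner_smul_left, real_inner_smul_left, a1]; ring
  have wz : ⟪-Dx c x₀ z, w⟫ = (1 - θ) * ⟪-Dx c x₀ y₀, w⟫ + θ * ⟪-Dx c x₀ y₁, w⟫ := by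
    rw [hseg, inner_add_left, real_inner_smul_left, real_inner_smul_left]
  rw [inner_sub_left] at hw
  rw [a1] at T1
  rw [az] at Tz
  have hnc : Tendsto (fun t : ℝ => ‖ξ + t • w‖) (𝓝[>] 0) (𝓝 ‖ξ‖) := by
    have : ContinuousAt (fun t : ℝ => ‖ξ + t • w‖) 0 := by fun_prop
    have := this.tendsto.mono_left (nhdsWithin_le_nhds (s := Ioi 0))
    simpa using this
  have hnorm : ∀ t : ℝ, 0 < t → ‖t • ξ + t ^ 2 • w‖ = t * ‖ξ + t • w‖ := by
    intro t ht
    rw [show t • ξ + t ^ 2 • w = t • (ξ + t • w) by rw [smul_add, smul_smul, sq], norm_smul,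
      Real.norm_of_nonneg ht.le]
  have hh : Tendsto (fun t : ℝ => t * ‖ξ + t • w‖) (𝓝[>] 0) (𝓝[>] 0) := by
    refine tendsto_nhdsWithin_iff.mpr ⟨?_, ?_⟩
    · have := (tendsto_id.mono_left (nhdsWithin_le_nhds (a := (0:ℝ)) (s := Ioi 0))).mul hnc
      simpa using this
    · have hp : 0 < ‖ξ‖ := norm_pos_iff.mpr hξ0
      filter_upwards [self_mem_nhdsWithin, hnc.eventually (lt_mem_nhds hp)] with t ht ht'
      exact mul_pos ht ht'
  have Tη := (hη.comp hh).mul (hnc.pow 2)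
  have hin : ∀ᶠ t : ℝ in 𝓝[>] 0, x₀ + (t • ξ + t ^ 2 • w) ∈ Ω := by
    have : ContinuousAt (fun t : ℝ => x₀ + (t • ξ + t ^ 2 • w)) 0 := by fun_prop
    have := this.tendsto.mono_left (nhdsWithin_le_nhds (s := Ioi 0))
    refine this.eventually (hΩ.2.1.mem_nhds ?_)
    simpa using hx₀
  have hfin := le_of_tendsto_of_tendsto (Tz.sub Tη) (T0.max T1) (by
    filter_upwards [self_mem_nhdsWithin, hin] with t ht hmem
    have ht : 0 < t := ht
    have h := hA _ hmem
    rw [add_sub_cancel_left, hnorm t ht] at h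
    have e : η (t * ‖ξ + t • w‖) * ‖ξ + t • w‖ ^ 2
        = (η (t * ‖ξ + t • w‖) * (t * ‖ξ + t • w‖) ^ 2) / t ^ 2 := by
      field_simp
    simp only [Function.comp]
    rw [e, ← sub_div]
    rcases le_max_iff.mp h with h | h
    · refine le_max_of_le_left ?_
      refine div_le_div_of_nonneg_right ?_ (by positivity)
      linarith
    · refine le_max_of_le_right ?_
      refine div_le_div_of_nonneg_right ?_ (by positivity)
      linarith)
  rw [wz] at hfin
  rcases le_max_iff.mp hfin with h | h
  · linear_combination 2 * h - 2 * θ * hw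
  · linear_combination 2 * h - 2 * (θ - 1) * hw

/-- under A1, A2, mutual c-convexity and A3v, along a c-segment `θ ↦ y_θ` with
respect to `x₀`, for every `ξ ⟂ p₁ − p₀` the function `θ ↦ −D²_{xx}c(x₀,y_θ)(ξ,ξ)` is convex
on `[0,1]`; equivalently it lies below the corresponding chord. -/
theorem codimension_one_convexity {n : ℕ} (hn : 1 ≤ n)
    (Ω Ωs : Set (E n)) (c : E n → E n → ℝ)
    (hΩ : NiceDomain Ω) (hΩs : NiceDomain Ωs)
    (hc : CostC2 Ω Ωs c) (h1 : CondA1 Ω Ωs c) (h2 : CondA2 Ω Ωs c)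
    (hmc : MutuallyCConvex Ω Ωs c) (h3 : CondA3v Ω Ωs c)
    (x₀ : E n) (hx₀ : x₀ ∈ Ω) (y₀ y₁ : E n) (hy₀ : y₀ ∈ Ωs) (hy₁ : y₁ ∈ Ωs)
    (y : ℝ → E n) (hycont : ContinuousOn y (Icc 0 1)) (hy0 : y 0 = y₀) (hy1 : y 1 = y₁)
    (hymem : ∀ θ ∈ Icc (0:ℝ) 1, y θ ∈ Ωs)
    (hyseg : ∀ θ ∈ Icc (0:ℝ) 1,
      -Dx c x₀ (y θ) = (1 - θ) • (-Dx c x₀ y₀) + θ • (-Dx c x₀ y₁)) :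
    ∀ ξ : E n, ⟪ξ, (-Dx c x₀ y₁) - (-Dx c x₀ y₀)⟫ = 0 →
      ConvexOn ℝ (Icc 0 1) (fun θ => -DxxQ c x₀ (y θ) ξ) ∧
      ∀ θ ∈ Icc (0:ℝ) 1,
        -DxxQ c x₀ (y θ) ξ ≤ (1 - θ) * (-DxxQ c x₀ y₀ ξ) + θ * (-DxxQ c x₀ y₁ ξ) := by
  intro ξ hξ
  have main : ∀ a ∈ Icc (0:ℝ) 1, ∀ b ∈ Icc (0:ℝ) 1, ∀ s t : ℝ, 0 < s → 0 < t → s + t = 1 →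
      -DxxQ c x₀ (y (s * a + t * b)) ξ ≤
        s * (-DxxQ c x₀ (y a) ξ) + t * (-DxxQ c x₀ (y b) ξ) := by
    intro a ha b hb s t hs ht hst
    have hm : s * a + t * b ∈ Icc (0:ℝ) 1 := (convex_Icc (0:ℝ) 1) ha hb hs.le ht.le hst
    obtain rfl : s = 1 - t := by linarith
    refine aux_chord Ω Ωs c hΩ hc h1 h3 x₀ hx₀ (y a) (y b) (hymem a ha) (hymem b hb) t
      ⟨ht, by linarith⟩ _ (hymem _ hm) ?_ ξ ?_
    · rw [hyseg _ hm, hyseg a ha, hyseg b hb]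
      module
    · have e : -Dx c x₀ (y b) - -Dx c x₀ (y a) = (b - a) • (-Dx c x₀ y₁ - -Dx c x₀ y₀) := by
        rw [hyseg a ha, hyseg b hb]
        module
      rw [e, real_inner_smul_right, hξ, mul_zero]
  have hconv : ConvexOn ℝ (Icc 0 1) (fun θ => -DxxQ c x₀ (y θ) ξ) := by
    refine convexOn_iff_forall_pos.mpr ⟨convex_Icc 0 1, ?_⟩
    intro a ha b hb s t hs ht hst
    simpa only [smul_eq_mul] using main a ha b hb s t hs ht hst
  refine ⟨hconv, fun θ hθ => ?_⟩
  have := hconv.2 (left_mem_Icc.mpr zero_le_one) (right_mem_Icc.mpr zero_le_one)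
    (sub_nonneg.mpr hθ.2) hθ.1 (by ring : (1 - θ) + θ = 1)
  simpa only [smul_eq_mul, mul_zero, mul_one, zero_add, hy0, hy1] using this
end
end

section
/- Let U ⊆ ℝⁿ be an open convex set and let s : U → ℝ be continuously differentiable on U. Suppose there is a continuous function ε : ℝⁿ → ℝ with ε(0) = 0 such that for (Lebesgue-)almost every pair (x₀, x) ∈ U × U one has s(x) ≥ s(x₀) + ⟨∇s(x₀), x − x₀⟩ − ε(x − x₀)·|x − x₀|². Then s is convex on U. -/
open Set Filter Topology MeasureTheory RealInnerProductSpace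

noncomputable section

/-- a C¹ function on an open convex set that admits almost-everywhere
quadratically-perturbed supporting tangent planes is convex. -/
theorem ae_supporting_tangents_implies_convex {n : ℕ} (hn : 1 ≤ n)
    (U : Set (E n)) (hUo : IsOpen U) (hUc : Convex ℝ U)
    (s : E n → ℝ) (hs : ContDiffOn ℝ 1 s U)
    (ε : E n → ℝ) (hεc : Continuous ε) (hε0 : ε 0 = 0)
    (h : ∀ᵐ p : E n × E n ∂volume, p ∈ U ×ˢ U →
      s p.2 ≥ s p.1 + ⟪gradient s p.1, p.2 - p.1⟫ - ε (p.2 - p.1) * ‖p.2 - p.1‖ ^ 2) :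
    ConvexOn ℝ U s := by
  have hd : ∀ x ∈ U, HasFDerivAt s (fderiv ℝ s x) x := fun x hx =>
    ((hs.differentiableOn (by norm_num)).differentiableAt (hUo.mem_nhds hx)).hasFDerivAt
  have hfc : ContinuousOn (fderiv ℝ s) U := hs.continuousOn_fderiv_of_isOpen hUo le_rfl
  have hin : ∀ x v : E n, ⟪gradient s x, v⟫ = fderiv ℝ s x v := fun x v => by
    simp [gradient]
  -- the inequality holds everywhere
  have key : ∀ x ∈ U, ∀ y ∈ U,
      s x + fderiv ℝ s x (y - x) - ε (y - x) * ‖y - x‖ ^ 2 ≤ s y := by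
    let f : E n × E n → ℝ := fun p =>
      s p.2 - (s p.1 + fderiv ℝ s p.1 (p.2 - p.1) - ε (p.2 - p.1) * ‖p.2 - p.1‖ ^ 2)
    have m1 : MapsTo (Prod.fst : E n × E n → E n) (U ×ˢ U) U := fun p hp => hp.1
    have m2 : MapsTo (Prod.snd : E n × E n → E n) (U ×ˢ U) U := fun p hp => hp.2
    have hf : ContinuousOn f (U ×ˢ U) := by
      have c1 : ContinuousOn (fun p : E n × E n => s p.1) (U ×ˢ U) :=
        hs.continuousOn.comp continuousOn_fst m1
      have c2 : ContinuousOn (fun p : E n × E n => s p.2) (U ×ˢ U) :=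
        hs.continuousOn.comp continuousOn_snd m2
      have c3 : ContinuousOn (fun p : E n × E n => fderiv ℝ s p.1) (U ×ˢ U) :=
        hfc.comp continuousOn_fst m1
      have c4 : ContinuousOn (fun p : E n × E n => p.2 - p.1) (U ×ˢ U) := by fun_prop
      have c5 := c3.clm_apply c4
      have c6 : ContinuousOn (fun p : E n × E n => ε (p.2 - p.1) * ‖p.2 - p.1‖ ^ 2)
        (U ×ˢ U) := by fun_prop
      exact c2.sub ((c1.add c5).sub c6)
    have ho : IsOpen ((U ×ˢ U) ∩ f ⁻¹' Iio 0) :=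
      hf.isOpen_inter_preimage (hUo.prod hUo) isOpen_Iio
    have h0 : volume ((U ×ˢ U) ∩ f ⁻¹' Iio 0) = 0 := by
      refine measure_mono_null ?_ h
      rintro p ⟨hp, hp2⟩ hc
      have := hc hp
      rw [hin] at this
      have hp2' : f p < 0 := hp2
      simp only [f] at hp2'
      linarith
    have he := ho.measure_eq_zero_iff volume |>.1 h0
    intro x hx y hy
    by_contra hlt
    have : (x, y) ∈ ((U ×ˢ U) ∩ f ⁻¹' Iio 0) := by
      refine ⟨⟨hx, hy⟩, ?_⟩
      change f (x, y) < 0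
      simp only [f]
      linarith
    rw [he] at this
    exact this
  -- monotone gradient
  have mono : ∀ x ∈ U, ∀ y ∈ U, fderiv ℝ s x (y - x) ≤ fderiv ℝ s y (y - x) := by
    intro x hx y hy
    set v := y - x with hv
    have bound : ∀ N : ℕ, 0 < N →
        -(ε ((1 / (N : ℝ)) • v) + ε (-((1 / (N : ℝ)) • v))) * ‖v‖ ^ 2 ≤
          fderiv ℝ s y v - fderiv ℝ s x v := by
      intro N hN
      have hNr : (0 : ℝ) < N := by exact_mod_cast hN
      let p : ℕ → E n := fun i => x + ((i : ℝ) / N) • v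
      have hp : ∀ i ≤ N, p i ∈ U := by
        intro i hi
        refine hUc.add_smul_sub_mem hx hy ⟨by positivity, ?_⟩
        rw [div_le_one hNr]; exact_mod_cast hi
      have hstep : ∀ i < N, -(ε ((1 / (N : ℝ)) • v) + ε (-((1 / (N : ℝ)) • v))) * ‖v‖ ^ 2 / N
          ≤ fderiv ℝ s (p (i + 1)) v - fderiv ℝ s (p i) v := by
        intro i hi
        have e1 : p (i + 1) - p i = (1 / (N : ℝ)) • v := by
          simp only [p]
          rw [add_sub_add_left_eq_sub, ← sub_smul]
          congr 1
          push_cast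
          ring
        have e2 : p i - p (i + 1) = -((1 / (N : ℝ)) • v) := by rw [← e1]; abel
        have k1 := key _ (hp i hi.le) _ (hp (i + 1) hi)
        have k2 := key _ (hp (i + 1) hi) _ (hp i hi.le)
        rw [e1] at k1
        rw [e2] at k2
        rw [norm_neg, map_neg] at k2
        rw [map_smul, smul_eq_mul] at k1 k2
        have en : ‖(1 / (N : ℝ)) • v‖ = (1 / N) * ‖v‖ := by
          rw [norm_smul, Real.norm_of_nonneg (by positivity)]
        rw [en] at k1 k2
        rw [div_le_iff₀ hNr]
        generalize ε ((1 / (N : ℝ)) • v) = a at *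
        generalize ε (-((1 / (N : ℝ)) • v)) = b at *
        generalize fderiv ℝ s (p (i + 1)) v = A at *
        generalize fderiv ℝ s (p i) v = B at *
        have k3 : 0 ≤ (1 / (N : ℝ)) * (A - B) + (a + b) * ((1 / N) * ‖v‖) ^ 2 := by linarith
        have k4 := mul_nonneg (sq_nonneg (N : ℝ)) k3
        have k5 : (N : ℝ) ^ 2 * ((1 / (N : ℝ)) * (A - B) + (a + b) * ((1 / N) * ‖v‖) ^ 2)
          = (A - B) * N + (a + b) * ‖v‖ ^ 2 := by field_simp
        linarith
      have hsum := Finset.sum_le_sum (fun i hi => hstep i (Finset.mem_range.1 hi))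
      rw [Finset.sum_range_sub (fun i => fderiv ℝ s (p i) v)] at hsum
      have p0 : p 0 = x := by simp [p]
      have pN : p N = y := by simp [p, hNr.ne', hv]
      rw [p0, pN, Finset.sum_const, Finset.card_range, nsmul_eq_mul,
        mul_div_cancel₀ _ hNr.ne'] at hsum
      exact hsum
    have hl : Tendsto (fun N : ℕ => (1 / (N : ℝ)) • v) atTop (𝓝 0) := by
      simpa using (tendsto_one_div_atTop_nhds_zero_nat (𝕜 := ℝ)).smul_const v
    have ht1 : Tendsto (fun N : ℕ => ε ((1 / (N : ℝ)) • v)) atTop (𝓝 0) := by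
      have := (hεc.tendsto 0).comp hl
      rwa [hε0] at this
    have ht2 : Tendsto (fun N : ℕ => ε (-((1 / (N : ℝ)) • v))) atTop (𝓝 0) := by
      have h2 := hl.neg
      rw [neg_zero] at h2
      have := (hεc.tendsto 0).comp h2
      rwa [hε0] at this
    have ht := ((ht1.add ht2).neg).mul_const (‖v‖ ^ 2)
    simp only [add_zero, neg_zero, zero_mul] at ht
    have := le_of_tendsto ht ((eventually_gt_atTop 0).mono bound)
    linarith
  -- supporting tangents
  have supp : ∀ x ∈ U, ∀ y ∈ U, s x + fderiv ℝ s x (y - x) ≤ s y := by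
    intro x hx y hy
    obtain ⟨z, hz, hze⟩ := domain_mvt (fun z hz => (hd z hz).hasFDerivWithinAt) hUc hx hy
    have hzU := hUc.segment_subset hx hy hz
    rw [segment_eq_image'] at hz
    obtain ⟨t, ht, rfl⟩ := hz
    have hm := mono x hx _ hzU
    simp only [add_sub_cancel_left, map_smul, smul_eq_mul] at hm hze
    rcases ht.1.eq_or_lt with h0 | h0
    · subst h0
      simp only [zero_smul, add_zero] at hze
      linarith
    · have := le_of_mul_le_mul_left hm h0
      linarith
  refine ⟨hUc, fun x hx y hy a b ha hb hab => ?_⟩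
  have hz := hUc hx hy ha hb hab
  have h1 := mul_le_mul_of_nonneg_left (supp _ hz x hx) ha
  have h2 := mul_le_mul_of_nonneg_left (supp _ hz y hy) hb
  simp only [smul_eq_mul]
  set z := a • x + b • y with hzd
  have h3 : a * fderiv ℝ s z (x - z) + b * fderiv ℝ s z (y - z) = 0 := by
    rw [← smul_eq_mul, ← smul_eq_mul, ← map_smul, ← map_smul, ← map_add]
    have : a • (x - z) + b • (y - z) = 0 := by
      have : a • (x - z) + b • (y - z) = (a • x + b • y) - (a + b) • z := by module
      rw [this, hab, one_smul, hzd, sub_self]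
    rw [this, map_zero]
  have h4 : a * s z + b * s z = s z := by rw [← add_mul, hab, one_mul]
  linarith
end
end
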